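/- arXiv:math/0212008 — 6 statements merged into one kernel-verified Lean document; each statement's English description precedes it below -/
import Mathlib

section
/- Let κ > 0 and set α = 1 − 4/κ and β = 8/κ − 1. If F is holomorphic on the upper half-plane ℍ and satisfies F'(w)·(κ − (2/w)(1+w)) + (κ/2)·F''(w)·(w−1) = 0 for every w ∈ ℍ, then there exists a constant c ∈ ℂ such that F'(w) = c·w^{α−1}·(w−1)^{β−1} for all w ∈ ℍ, where the complex powers are principal-branch powers. -/
open Complex

/-- For `κ > 0`, `α = 1 - 4/κ`, `β = 8/κ - 1`, any holomorphic `F` on the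
upper half-plane satisfying `F'(w)·(κ − (2/w)(1+w)) + (κ/2)·F''(w)·(w−1) = 0` has
`F'(w) = c · w^(α−1) · (w−1)^(β−1)` for some constant `c` (principal-branch powers). -/
theorem stmt1 (κ : ℝ) (hκ : 0 < κ) (α β : ℝ) (hα : α = 1 - 4 / κ) (hβ : β = 8 / κ - 1)
    (F : ℂ → ℂ) (hF : DifferentiableOn ℂ F {z : ℂ | 0 < z.im})
    (heq : ∀ w : ℂ, 0 < w.im →
      deriv F w * ((κ : ℂ) - (2 / w) * (1 + w))
        + ((κ : ℂ) / 2) * deriv (deriv F) w * (w - 1) = 0) :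
    ∃ c : ℂ, ∀ w : ℂ, 0 < w.im →
      deriv F w = c * w ^ ((α : ℂ) - 1) * (w - 1) ^ ((β : ℂ) - 1) := by
  have hopen : IsOpen {z : ℂ | 0 < z.im} := isOpen_lt continuous_const Complex.continuous_im
  have hconv : Convex ℝ {z : ℂ | 0 < z.im} := convex_halfSpace_im_gt 0
  have hκ' : (κ : ℂ) ≠ 0 := by exact_mod_cast hκ.ne'
  have hne : ∀ w : ℂ, 0 < w.im → w ≠ 0 := by
    rintro w hw rfl
    simp at hw
  have hne1 : ∀ w : ℂ, 0 < w.im → w - 1 ≠ 0 := by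
    intro w hw h
    have := congrArg Complex.im h
    simp at this
    exact hw.ne' this
  set a : ℂ := (α : ℂ) - 1 with ha
  set b : ℂ := (β : ℂ) - 1 with hb
  have ha' : a = -4 / κ := by rw [ha, hα]; push_cast; ring
  have hb' : b = 8 / κ - 2 := by rw [hb, hβ]; push_cast; ring
  have hF' : DifferentiableOn ℂ (deriv F) {z : ℂ | 0 < z.im} := hF.deriv hopen
  let G : ℂ → ℂ := fun w => deriv F w * Complex.exp (-(Complex.log w * a + Complex.log (w - 1) * b))
  have hG : ∀ w : ℂ, 0 < w.im → HasDerivAt G 0 w := by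
    intro w hw
    have h0 := hne w hw
    have h1 := hne1 w hw
    have d1 : HasDerivAt (deriv F) (deriv (deriv F) w) w :=
      (hF'.differentiableAt (hopen.mem_nhds hw)).hasDerivAt
    have l1 : HasDerivAt Complex.log w⁻¹ w := Complex.hasDerivAt_log (Or.inr hw.ne')
    have l2 : HasDerivAt (fun w : ℂ => Complex.log (w - 1)) (1 / (w - 1)) w :=
      ((hasDerivAt_id w).sub_const 1).clog (Or.inr (by simpa using hw.ne'))
    have := d1.mul (((l1.mul_const a).add (l2.mul_const b)).neg.cexp)
    refine this.congr_deriv ?_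
    have e := heq w hw
    have key : deriv (deriv F) w = deriv F w * (w⁻¹ * a + 1 / (w - 1) * b) := by
      rw [ha', hb']
      field_simp at e ⊢
      linear_combination e
    rw [key]
    simp only [Pi.add_apply, Pi.neg_apply]
    ring
  have hconst : ∀ w : ℂ, 0 < w.im → G w = G Complex.I := by
    intro w hw
    refine hopen.is_const_of_deriv_eq_zero hconv.isPreconnected
      (fun z hz => (hG z hz).differentiableAt.differentiableWithinAt)
      (fun z hz => (hG z hz).deriv) hw ?_
    simp
  refine ⟨G Complex.I, fun w hw => ?_⟩
  rw [← hconst w hw, Complex.cpow_def_of_ne_zero (hne w hw), Complex.cpow_def_of_ne_zero (hne1 w hw),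
    mul_assoc, ← Complex.exp_add]
  simp only [G]
  rw [mul_assoc, ← Complex.exp_add]
  simp
end

section
/- Let 0 < κ ≤ 4, let (B_t)_{t≥0} be a standard real Brownian motion started from 0, and set W_t = √κ·B_t. Suppose (Y_t)_{t≥0} is a continuous process such that almost surely Y_t > 0 for all t ≥ 0 and Y_t = 1 − W_t + ∫_0^t (2/Y_s) ds for all t ≥ 0 (so that Y/√κ is a Bessel process of dimension 1 + 4/κ ≥ 2 started from 1/√κ). Then almost surely ∫_0^∞ dt / Y_t² = ∞. -/
open MeasureTheory ProbabilityTheory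

/-- A standard real Brownian motion: a process with continuous paths, starting at `0`,
which is a centered Gaussian process with covariance `Cov(B_s, B_t) = min s t`; this is
expressed by requiring each finite linear combination `∑ cᵢ B_{tᵢ}` (times `tᵢ ≥ 0`) to be
a centered Gaussian variable with the variance `∑ᵢ ∑ⱼ cᵢ cⱼ min tᵢ tⱼ` dictated by that
covariance. -/
def IsStandardBrownianMotion {Ω : Type*} [MeasurableSpace Ω] (μ : Measure Ω)
    (B : ℝ → Ω → ℝ) : Prop :=
  (∀ ω, Continuous fun t => B t ω) ∧
  (∀ ω, B 0 ω = 0) ∧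
  ∀ (n : ℕ) (t : Fin n → ℝ), (∀ i, 0 ≤ t i) → ∀ c : Fin n → ℝ,
    Measure.map (fun ω => ∑ i, c i * B (t i) ω) μ =
      gaussianReal 0 (Real.toNNReal (∑ i, ∑ j, c i * c j * min (t i) (t j)))

/-- Pathwise upper bound on the solution. -/
lemma path_bound (f w : ℝ → ℝ) (hf : Continuous f) (T M : ℝ) (hT : 1 ≤ T)
    (h : ∀ t : ℝ, 0 ≤ t → 0 < f t ∧ f t = 1 - w t + ∫ s in (0 : ℝ)..t, 2 / f s)
    (hw0 : w 0 = 0) (hM : ∀ t ∈ Set.Icc 0 (2 * T), |w t| ≤ M) :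
    ∀ t ∈ Set.Icc 0 (2 * T), f t ≤ 5 * Real.sqrt T + 2 * M := by
  intro t ht
  have ha : 1 ≤ Real.sqrt T := Real.one_le_sqrt.mpr hT
  have hTT : Real.sqrt T * Real.sqrt T = T := Real.mul_self_sqrt (by linarith)
  have hf0 : f 0 = 1 := by
    have := (h 0 le_rfl).2
    simpa [hw0] using this
  have hcomp : IsCompact (Set.Icc 0 t ∩ {s | f s ≤ Real.sqrt T}) :=
    isCompact_Icc.inter_right (isClosed_le hf continuous_const)
  obtain ⟨s, ⟨hs1, hs2⟩, hs3⟩ := hcomp.exists_isGreatest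
    ⟨0, ⟨⟨le_rfl, ht.1⟩, by simp only [Set.mem_ofPred_eq, hf0]; exact ha⟩⟩
  have hs2' : f s ≤ Real.sqrt T := hs2
  have hint : ∀ b : ℝ, 0 ≤ b → IntervalIntegrable (fun s => 2 / f s) volume 0 b := by
    intro b hb
    apply ContinuousOn.intervalIntegrable
    intro x hx
    rw [Set.uIcc_of_le hb] at hx
    exact (continuousAt_const.div hf.continuousAt (h x hx.1).1.ne').continuousWithinAt
  have e1 := (h t ht.1).2
  have e2 := (h s hs1.1).2
  have e3 := intervalIntegral.integral_interval_sub_left (hint t ht.1) (hint s hs1.1)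
  have e4 : ‖∫ x in s..t, 2 / f x‖ ≤ (2 / Real.sqrt T) * |t - s| := by
    apply intervalIntegral.norm_integral_le_of_norm_le_const
    intro x hx
    rw [Set.uIoc_of_le hs1.2] at hx
    have hx0 : 0 ≤ x := hs1.1.trans hx.1.le
    have hfx : Real.sqrt T ≤ f x := by
      by_contra hcon
      push Not at hcon
      have := hs3 ⟨⟨hx0, hx.2⟩, hcon.le⟩
      linarith [hx.1]
    rw [Real.norm_of_nonneg (div_nonneg zero_le_two (h x hx0).1.le)]
    gcongr
  have e5 : (2 / Real.sqrt T) * |t - s| ≤ 4 * Real.sqrt T := by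
    rw [abs_of_nonneg (by linarith [hs1.2]), div_mul_eq_mul_div, div_le_iff₀ (by linarith)]
    nlinarith [ht.2, hs1.1]
  have e6 := le_trans (le_trans (le_abs_self _) e4) e5
  have m1 := abs_le.mp (hM t ht)
  have m2 := abs_le.mp (hM s ⟨hs1.1, hs1.2.trans ht.2⟩)
  linarith [m1.1, m2.2]

lemma lintegral_top (f : ℝ → ℝ) (K : ℝ) (hK : 0 < K)
    (hpos : ∀ t, 0 ≤ t → 0 < f t)
    (h : ∃ᶠ n : ℕ in Filter.atTop, ∀ t ∈ Set.Icc 0 (2 * (2 : ℝ) ^ n),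
      f t ≤ K * Real.sqrt (2 ^ n)) :
    ∫⁻ t in Set.Ioi (0 : ℝ), ENNReal.ofReal (1 / (f t) ^ 2) = ⊤ := by
  by_contra hne
  set g : ℝ → ENNReal := fun t => ENNReal.ofReal (1 / (f t) ^ 2) with hg
  have hmono : Monotone (fun n : ℕ => (2 : ℝ) ^ n) := fun a b hab =>
    pow_le_pow_right₀ one_le_two hab
  have hsub : (⋃ n : ℕ, Set.Ioc ((2 : ℝ) ^ n) (2 ^ (n + 1))) ⊆ Set.Ioi 0 := by
    intro x hx
    obtain ⟨n, hn⟩ := Set.mem_iUnion.mp hx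
    exact lt_trans (by positivity) hn.1
  have hsum : ∑' n : ℕ, ∫⁻ t in Set.Ioc ((2 : ℝ) ^ n) (2 ^ (n + 1)), g t ≠ ⊤ := by
    rw [← lintegral_iUnion (s := fun n : ℕ => Set.Ioc ((2 : ℝ) ^ n) (2 ^ (n + 1)))
      (fun _ => measurableSet_Ioc) hmono.pairwise_disjoint_on_Ioc_succ]
    exact ne_top_of_le_ne_top hne (lintegral_mono_set hsub)
  have ht := ENNReal.tendsto_atTop_zero_of_tsum_ne_top hsum
  have hev := ht.eventually (gt_mem_nhds (show (0 : ENNReal) < ENNReal.ofReal (1 / K ^ 2) by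
    rw [ENNReal.ofReal_pos]; positivity))
  obtain ⟨n, hn1, hn2⟩ := (h.and_eventually hev).exists
  refine absurd hn2 (not_lt.mpr ?_)
  have h2 : (0 : ℝ) < 2 ^ n := by positivity
  calc ENNReal.ofReal (1 / K ^ 2)
      = ∫⁻ t in Set.Ioc ((2 : ℝ) ^ n) (2 ^ (n + 1)), ENNReal.ofReal (1 / (K ^ 2 * 2 ^ n)) := by
        rw [setLIntegral_const, Real.volume_Ioc, ← ENNReal.ofReal_mul (by positivity)]
        congr 1
        rw [pow_succ]
        field_simp
        ring
    _ ≤ _ := by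
        apply setLIntegral_mono' measurableSet_Ioc
        intro t ht
        have ht0 : 0 ≤ t := h2.le.trans ht.1.le
        have hft := hpos t ht0
        have hb := hn1 t ⟨ht0, by have := ht.2; rw [pow_succ] at this; linarith⟩
        apply ENNReal.ofReal_le_ofReal
        apply one_div_le_one_div_of_le (by positivity)
        have : (K * Real.sqrt (2 ^ n)) ^ 2 = K ^ 2 * 2 ^ n := by
          rw [mul_pow, Real.sq_sqrt h2.le]
        rw [← this]
        gcongr

section
variable {Ω : Type*} [MeasurableSpace Ω] {μ : Measure Ω} [IsProbabilityMeasure μ]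
  {B : ℝ → Ω → ℝ}

lemma bm_fintype (hB : IsStandardBrownianMotion μ B) {ι : Type*} [Fintype ι]
    (t : ι → ℝ) (ht : ∀ i, 0 ≤ t i) (c : ι → ℝ) :
    Measure.map (fun ω => ∑ i, c i * B (t i) ω) μ =
      gaussianReal 0 (Real.toNNReal (∑ i, ∑ j, c i * c j * min (t i) (t j))) := by
  let e := (Fintype.equivFin ι).symm
  have := hB.2.2 _ (t ∘ e) (fun i => ht _) (c ∘ e)
  simp only [Function.comp_apply] at this
  have h1 : ∀ ω, ∑ i, c (e i) * B (t (e i)) ω = ∑ i, c i * B (t i) ω := fun ω =>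
    e.sum_comp (fun i => c i * B (t i) ω)
  have h2 : ∑ i, ∑ j, c (e i) * c (e j) * min (t (e i)) (t (e j)) =
      ∑ i, ∑ j, c i * c j * min (t i) (t j) := by
    rw [← e.sum_comp]
    refine Finset.sum_congr rfl fun i _ => ?_
    exact e.sum_comp (fun j => c (e i) * c j * min (t (e i)) (t j))
  simp only [h1, h2] at this
  exact this

lemma bm_aemeas (hB : IsStandardBrownianMotion μ B) (t : ℝ) (ht : 0 ≤ t) :
    AEMeasurable (B t) μ := by
  by_contra hne
  have := hB.2.2 1 (fun _ => t) (fun _ => ht) (fun _ => 1)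
  simp only [Finset.univ_unique, Finset.sum_singleton, one_mul] at this
  rw [Measure.map_of_not_aemeasurable hne] at this
  exact (IsProbabilityMeasure.ne_zero _) this.symm

lemma bm_scaling (hB : IsStandardBrownianMotion μ B) (u : ℕ → ℝ) (hu : ∀ q, 0 ≤ u q)
    (T : ℝ) (hT : 0 < T) :
    μ.map (fun ω (q : ℕ) => (Real.sqrt T)⁻¹ * B (T * u q) ω) =
      μ.map (fun ω (q : ℕ) => B (u q) ω) := by
  have m1 : ∀ q, AEMeasurable (fun ω => (Real.sqrt T)⁻¹ * B (T * u q) ω) μ := fun q =>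
    (bm_aemeas hB _ (mul_nonneg hT.le (hu q))).const_mul _
  have m2 : ∀ q, AEMeasurable (fun ω => B (u q) ω) μ := fun q => bm_aemeas hB _ (hu q)
  refine (map_eq_iff_forall_finset_map_restrict_eq
    (X := fun (q : ℕ) ω => (Real.sqrt T)⁻¹ * B (T * u q) ω) (Y := fun q ω => B (u q) ω)
    (aemeasurable_pi_lambda _ m1) (aemeasurable_pi_lambda _ m2)).mpr ?_
  intro I
  have n1 : AEMeasurable (fun ω => I.restrict
      (fun q : ℕ => (Real.sqrt T)⁻¹ * B (T * u q) ω)) μ :=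
    aemeasurable_pi_lambda _ fun i => m1 i
  have n2 : AEMeasurable (fun ω => I.restrict (fun q : ℕ => B (u q) ω)) μ :=
    aemeasurable_pi_lambda _ fun i => m2 i
  have : IsProbabilityMeasure (μ.map (fun ω => I.restrict
      (fun q : ℕ => (Real.sqrt T)⁻¹ * B (T * u q) ω))) := Measure.isProbabilityMeasure_map n1
  have : IsProbabilityMeasure (μ.map (fun ω => I.restrict
      (fun q : ℕ => B (u q) ω))) := Measure.isProbabilityMeasure_map n2
  apply Measure.ext_of_charFunDual
  ext L
  rw [charFunDual_eq_charFun_map_one, charFunDual_eq_charFun_map_one,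
    AEMeasurable.map_map_of_aemeasurable (by fun_prop) n1,
    AEMeasurable.map_map_of_aemeasurable (by fun_prop) n2]
  congr 1
  have hL : ∀ x : I → ℝ, L x = ∑ i, L (Pi.single i 1) * x i := by
    intro x
    conv_lhs => rw [← Finset.univ_sum_single x]
    rw [map_sum]
    refine Finset.sum_congr rfl fun i _ => ?_
    have : (Pi.single i (x i) : I → ℝ) = x i • Pi.single i (1 : ℝ) := by
      rw [← Pi.single_smul]; simp
    rw [this, map_smul, smul_eq_mul, mul_comm]
  have f1 : (L ∘ fun ω => I.restrict (fun q : ℕ => (Real.sqrt T)⁻¹ * B (T * u q) ω)) =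
      fun ω => ∑ i : I, (L (Pi.single i 1) * (Real.sqrt T)⁻¹) * B (T * u i) ω := by
    ext ω
    simp only [Function.comp_apply]
    rw [hL]
    refine Finset.sum_congr rfl fun i _ => ?_
    simp only [Finset.restrict]
    ring
  have f2 : (L ∘ fun ω => I.restrict (fun q : ℕ => B (u q) ω)) =
      fun ω => ∑ i : I, L (Pi.single i 1) * B (u i) ω := by
    ext ω
    simp only [Function.comp_apply]
    rw [hL]
    rfl
  rw [f1, f2, bm_fintype hB (fun i : I => T * u i) (fun i => mul_nonneg hT.le (hu _)),
    bm_fintype hB (fun i : I => u i) (fun i => hu _)]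
  congr 2
  refine Finset.sum_congr rfl fun i _ => Finset.sum_congr rfl fun j _ => ?_
  rw [← mul_min_of_nonneg _ _ hT.le]
  have hs : (Real.sqrt T)⁻¹ * (Real.sqrt T)⁻¹ * T = 1 := by
    rw [← mul_inv, Real.mul_self_sqrt hT.le, inv_mul_cancel₀ hT.ne']
  linear_combination (L (Pi.single i 1) * L (Pi.single j 1) * min (u i) (u j)) * hs

lemma bm_tight (hB : IsStandardBrownianMotion μ B) (ε : ENNReal) (hε : 0 < ε) :
    ∃ C : ℝ, 0 ≤ C ∧ ∀ T : ℝ, 0 < T →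
      μ {ω | ∃ t ∈ Set.Icc 0 (2 * T), C * Real.sqrt T < |B t ω|} ≤ ε := by
  have : Nonempty (Set.Icc (0 : ℝ) 2) := ⟨⟨0, by norm_num⟩⟩
  let d : ℕ → Set.Icc (0 : ℝ) 2 := TopologicalSpace.denseSeq _
  have hd : DenseRange d := TopologicalSpace.denseRange_denseSeq _
  let u : ℕ → ℝ := fun q => d q
  have hu : ∀ q, 0 ≤ u q := fun q => (d q).2.1
  have m2 : AEMeasurable (fun ω (q : ℕ) => B (u q) ω) μ :=
    aemeasurable_pi_lambda _ fun q => bm_aemeas hB _ (hu q)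
  let A : ℕ → Set (ℕ → ℝ) := fun n => {x | ∃ q, (n : ℝ) < |x q|}
  have hA : ∀ n, MeasurableSet (A n) := by
    intro n
    have : A n = ⋃ q, {x | (n : ℝ) < |x q|} := by ext; simp [A]
    rw [this]
    exact MeasurableSet.iUnion fun q => measurableSet_lt (by fun_prop) (by fun_prop)
  set ν := μ.map (fun ω (q : ℕ) => B (u q) ω) with hν
  have : IsProbabilityMeasure ν := Measure.isProbabilityMeasure_map m2
  have hlim : Filter.Tendsto (fun n => ν (A n)) Filter.atTop (nhds (ν (⋂ n, A n))) := by
    apply tendsto_measure_iInter_atTop (fun n => (hA n).nullMeasurableSet)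
    · intro a b hab x hx
      obtain ⟨q, hq⟩ := hx
      exact ⟨q, lt_of_le_of_lt (by exact_mod_cast hab) hq⟩
    · exact ⟨0, measure_ne_top _ _⟩
  have hzero : ν (⋂ n, A n) = 0 := by
    rw [hν, Measure.map_apply_of_aemeasurable m2 (MeasurableSet.iInter hA)]
    convert measure_empty (μ := μ)
    ext ω
    simp only [Set.mem_preimage, Set.mem_iInter, Set.mem_empty_iff_false, iff_false, not_forall]
    obtain ⟨M, hM⟩ := (isCompact_Icc (a := (0 : ℝ)) (b := 2)).exists_bound_of_continuousOn
      (hB.1 ω).continuousOn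
    obtain ⟨n, hn⟩ := exists_nat_ge M
    refine ⟨n, ?_⟩
    rintro ⟨q, hq⟩
    have := hM (u q) (d q).2
    rw [Real.norm_eq_abs] at this
    linarith
  rw [hzero] at hlim
  obtain ⟨n, hn⟩ := (hlim.eventually (gt_mem_nhds hε)).exists
  refine ⟨n, Nat.cast_nonneg n, fun T hT => ?_⟩
  have hsT : 0 < Real.sqrt T := Real.sqrt_pos.mpr hT
  have m1 : AEMeasurable (fun ω (q : ℕ) => (Real.sqrt T)⁻¹ * B (T * u q) ω) μ :=
    aemeasurable_pi_lambda _ fun q =>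
      (bm_aemeas hB _ (mul_nonneg hT.le (hu q))).const_mul _
  rw [hν, ← bm_scaling hB u hu T hT, Measure.map_apply_of_aemeasurable m1 (hA n)] at hn
  refine le_trans (measure_mono ?_) hn.le
  rintro ω ⟨t, ht, hlt⟩
  have hopen : IsOpen {x : Set.Icc (0 : ℝ) 2 | (n : ℝ) * Real.sqrt T < |B (T * x) ω|} := by
    apply isOpen_lt continuous_const
    have := hB.1 ω
    exact (this.comp (continuous_const.mul continuous_subtype_val)).abs
  obtain ⟨q, hq⟩ := hd.exists_mem_open hopen ⟨⟨t / T, div_nonneg ht.1 hT.le, by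
    rw [div_le_iff₀ hT]; exact ht.2⟩, by
      simp only [Set.mem_ofPred_eq]
      rwa [mul_div_cancel₀ _ hT.ne']⟩
  refine ⟨q, ?_⟩
  simp only [Set.mem_ofPred_eq] at hq
  rw [abs_mul, abs_of_pos (inv_pos.mpr hsT), inv_mul_eq_div, lt_div_iff₀ hsT]
  exact hq

end

/-- Let `0 < κ ≤ 4`, `W = √κ·B` for a standard Brownian motion `B`, and let
`Y` be a continuous process with, almost surely, `Y_t > 0` and
`Y_t = 1 − W_t + ∫_0^t (2/Y_s) ds` for all `t ≥ 0` (so `Y/√κ` is a Bessel process of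
dimension `1 + 4/κ ≥ 2` started from `1/√κ`). Then almost surely `∫_0^∞ dt/Y_t² = ∞`. -/
theorem stmt3 {Ω : Type*} [MeasurableSpace Ω] (μ : Measure Ω) [IsProbabilityMeasure μ]
    (κ : ℝ) (hκ0 : 0 < κ) (hκ4 : κ ≤ 4)
    (B : ℝ → Ω → ℝ) (hB : IsStandardBrownianMotion μ B)
    (W : ℝ → Ω → ℝ) (hW : ∀ t ω, W t ω = Real.sqrt κ * B t ω)
    (Y : ℝ → Ω → ℝ) (hYcont : ∀ ω, Continuous fun t => Y t ω)
    (hY : ∀ᵐ ω ∂μ, ∀ t : ℝ, 0 ≤ t →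
      0 < Y t ω ∧ Y t ω = 1 - W t ω + ∫ s in (0 : ℝ)..t, 2 / Y s ω) :
    ∀ᵐ ω ∂μ, ∫⁻ t in Set.Ioi (0 : ℝ), ENNReal.ofReal (1 / (Y t ω) ^ 2) = ⊤ := by
  rw [ae_iff]
  refine le_antisymm (le_of_forall_gt_imp_ge_of_dense fun ε hε => ?_) bot_le
  obtain ⟨C, hC0, hC⟩ := bm_tight hB ε hε
  let E : ℕ → Set Ω := fun n =>
    {ω | ∃ t ∈ Set.Icc 0 (2 * (2 : ℝ) ^ n), C * Real.sqrt (2 ^ n) < |B t ω|}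
  have hE : ∀ n, μ (E n) ≤ ε := fun n => hC _ (by positivity)
  have hU : μ (⋃ N, ⋂ n ≥ N, E n) ≤ ε := by
    rw [Monotone.measure_iUnion]
    · exact iSup_le fun N => (measure_mono (Set.biInter_subset_of_mem (le_refl N))).trans (hE N)
    · intro a b hab
      exact Set.biInter_subset_biInter_left fun n hn => le_trans hab hn
  refine le_trans (measure_mono_ae ?_) hU
  filter_upwards [hY] with ω hω hbad
  by_contra hcon
  apply hbad
  have hfreq : ∃ᶠ n : ℕ in Filter.atTop, ω ∉ E n := by
    intro hev
    apply hcon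
    obtain ⟨N, hN⟩ := Filter.eventually_atTop.mp hev
    refine Set.mem_iUnion.mpr ⟨N, Set.mem_iInter₂.mpr fun n hn => ?_⟩
    exact not_not.mp (hN n hn)
  have hsk : 0 ≤ Real.sqrt κ := Real.sqrt_nonneg κ
  refine lintegral_top (fun t => Y t ω) (5 + 2 * (Real.sqrt κ * C)) (by positivity)
    (fun t ht => (hω t ht).1) (hfreq.mono fun n hn t ht => ?_)
  have := path_bound (fun t => Y t ω) (fun t => W t ω) (hYcont ω) (2 ^ n)
    (Real.sqrt κ * (C * Real.sqrt (2 ^ n))) (one_le_pow₀ one_le_two) hω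
    (by simp [hW, hB.2.1]) (by
      intro t ht
      rw [hW, abs_mul, abs_of_nonneg hsk]
      apply mul_le_mul_of_nonneg_left _ hsk
      by_contra hc
      exact hn ⟨t, ht, not_le.mp hc⟩) t ht
  calc Y t ω ≤ _ := this
    _ = _ := by ring
end

section
/- Let κ > 4, let (B_t)_{t≥0} be a standard real Brownian motion started from 0, and set W_t = √κ·B_t. Let τ ∈ (0, ∞] be a random time and suppose (Y_t)_{0≤t<τ} is a continuous process such that almost surely Y_t > 0 and Y_t = 1 − W_t + ∫_0^t (2/Y_s) ds for all 0 ≤ t < τ, and such that almost surely liminf_{t↑τ} Y_t = 0 (with τ < ∞ almost surely; Y/√κ is a Bessel process of dimension 1 + 4/κ < 2 started from 1/√κ and run until it first hits 0). Then almost surely ∫_0^τ dt / Y_t² = ∞. -/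
open MeasureTheory ProbabilityTheory Filter

lemma bm_incr_map {Ω : Type*} [MeasurableSpace Ω] {μ : Measure Ω}
    {B : ℝ → Ω → ℝ} (hB : IsStandardBrownianMotion μ B) (s t : ℝ) (hs : 0 ≤ s) (hst : s ≤ t) :
    Measure.map (fun ω => B t ω - B s ω) μ = gaussianReal 0 (Real.toNNReal (t - s)) := by
  have h := hB.2.2 2 ![s, t] (by
    intro i
    fin_cases i
    · simpa using hs
    · simpa using hs.trans hst) ![-1, 1]
  have e1 : (fun ω => ∑ i, (![-1, 1] : Fin 2 → ℝ) i * B ((![s, t] : Fin 2 → ℝ) i) ω)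
      = fun ω => B t ω - B s ω := by
    funext ω
    simp [Fin.sum_univ_two]
    ring
  have e2 : (∑ i, ∑ j, (![-1, 1] : Fin 2 → ℝ) i * (![-1, 1] : Fin 2 → ℝ) j *
      min ((![s, t] : Fin 2 → ℝ) i) ((![s, t] : Fin 2 → ℝ) j)) = t - s := by
    simp [Fin.sum_univ_two, min_eq_left hst, min_eq_right hst]
    ring
  rw [e1, e2] at h
  exact h

lemma bm_incr_subgaussian {Ω : Type*} [MeasurableSpace Ω] {μ : Measure Ω}
    [IsProbabilityMeasure μ]
    {B : ℝ → Ω → ℝ} (hB : IsStandardBrownianMotion μ B) (s t : ℝ) (hs : 0 ≤ s) (hst : s ≤ t) :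
    HasSubgaussianMGF (fun ω => B t ω - B s ω) (Real.toNNReal (t - s)) μ := by
  have hmap := bm_incr_map hB s t hs hst
  have hX : AEMeasurable (fun ω => B t ω - B s ω) μ :=
    aemeasurable_of_map_neZero (by rw [hmap]; infer_instance)
  refine ⟨fun r => ?_, fun r => ?_⟩
  · have := integrable_exp_mul_gaussianReal (μ := 0) (v := Real.toNNReal (t - s)) r
    rw [← hmap] at this
    exact this.comp_aemeasurable hX
  · rw [mgf_gaussianReal hmap r]
    simp

lemma bm_incr_tail {Ω : Type*} [MeasurableSpace Ω] {μ : Measure Ω} [IsProbabilityMeasure μ]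
    {B : ℝ → Ω → ℝ} (hB : IsStandardBrownianMotion μ B) (s t : ℝ) (hs : 0 ≤ s) (hst : s ≤ t)
    (x : ℝ) (hx : 0 ≤ x) :
    μ {ω | x ≤ |B t ω - B s ω|} ≤ ENNReal.ofReal (2 * Real.exp (-x ^ 2 / (2 * (t - s)))) := by
  have h := bm_incr_subgaussian hB s t hs hst
  have h1 := h.measure_ge_le hx
  have h2 := h.neg.measure_ge_le hx
  rw [Real.coe_toNNReal _ (sub_nonneg.2 hst)] at h1 h2
  have hsub : {ω | x ≤ |B t ω - B s ω|} ⊆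
      {ω | x ≤ B t ω - B s ω} ∪ {ω | x ≤ (-(fun ω => B t ω - B s ω)) ω} := by
    intro ω hω
    rcases le_abs.1 (show x ≤ |B t ω - B s ω| from hω) with h | h
    · exact Or.inl h
    · exact Or.inr h
  have h3 : μ.real {ω | x ≤ |B t ω - B s ω|} ≤ 2 * Real.exp (-x ^ 2 / (2 * (t - s))) := by
    refine (measureReal_mono hsub).trans ((measureReal_union_le _ _).trans ?_)
    linarith
  rw [← ofReal_measureReal]
  exact ENNReal.ofReal_le_ofReal h3

/-- dyadic increments of a Brownian path, eventually controlled -/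
lemma bm_dyadic {Ω : Type*} [MeasurableSpace Ω] {μ : Measure Ω} [IsProbabilityMeasure μ]
    {B : ℝ → Ω → ℝ} (hB : IsStandardBrownianMotion μ B) :
    ∀ᵐ ω ∂μ, ∀ᶠ n : ℕ in atTop, ∀ k : ℕ, k < 4 ^ n →
      |B (((k : ℝ) + 1) / 2 ^ n) ω - B ((k : ℝ) / 2 ^ n) ω| ≤ 3 * Real.sqrt (n / 2 ^ n) := by
  let S : ℕ → Set Ω := fun n => ⋃ k ∈ Finset.range (4 ^ n),
    {ω | 3 * Real.sqrt (n / 2 ^ n) ≤ |B (((k : ℝ) + 1) / 2 ^ n) ω - B ((k : ℝ) / 2 ^ n) ω|}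
  have hS : ∀ n, μ (S n) ≤ ENNReal.ofReal (2 * (1 / 2 : ℝ) ^ n) := by
    intro n
    have hp : (0 : ℝ) < 2 ^ n := by positivity
    have hk : ∀ k ∈ Finset.range (4 ^ n),
        μ {ω | 3 * Real.sqrt (n / 2 ^ n) ≤
          |B (((k : ℝ) + 1) / 2 ^ n) ω - B ((k : ℝ) / 2 ^ n) ω|} ≤
        ENNReal.ofReal (2 * (1 / 8 : ℝ) ^ n) := by
      intro k _
      refine (bm_incr_tail hB _ _ (by positivity) (by gcongr; linarith) _ (by positivity)).trans ?_
      refine ENNReal.ofReal_le_ofReal ?_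
      have e : -(3 * Real.sqrt (n / 2 ^ n)) ^ 2 /
          (2 * (((k : ℝ) + 1) / 2 ^ n - (k : ℝ) / 2 ^ n)) = n * (-(9 / 2) : ℝ) := by
        rw [mul_pow, Real.sq_sqrt (by positivity)]
        field_simp
        ring
      rw [e, Real.exp_nat_mul]
      gcongr
      rw [Real.exp_neg, one_div]
      gcongr
      have h1 : (1 : ℝ) + 1 ≤ Real.exp 1 := Real.add_one_le_exp 1
      calc (8 : ℝ) ≤ Real.exp 1 ^ 3 := by nlinarith [sq_nonneg (Real.exp 1)]
        _ = Real.exp 3 := by rw [← Real.exp_nat_mul]; norm_num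
        _ ≤ Real.exp (9 / 2) := Real.exp_le_exp.2 (by norm_num)
    calc μ (S n) ≤ ∑ k ∈ Finset.range (4 ^ n), _ := measure_biUnion_finset_le _ _
      _ ≤ ∑ k ∈ Finset.range (4 ^ n), ENNReal.ofReal (2 * (1 / 8 : ℝ) ^ n) :=
          Finset.sum_le_sum hk
      _ = ENNReal.ofReal (2 * (1 / 2 : ℝ) ^ n) := by
          rw [Finset.sum_const, Finset.card_range, ← ENNReal.ofReal_nsmul]
          congr 1
          rw [nsmul_eq_mul]
          push_cast
          have : (1 / 2 : ℝ) ^ n = 4 ^ n * (1 / 8) ^ n := by rw [← mul_pow]; norm_num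
          rw [this]
          ring
  have hsum : ∑' n, μ (S n) ≠ ⊤ := by
    have hsm : Summable fun n : ℕ => 2 * (1 / 2 : ℝ) ^ n :=
      (summable_geometric_of_lt_one (by norm_num) (by norm_num)).mul_left 2
    refine ne_top_of_le_ne_top ?_ (ENNReal.tsum_le_tsum hS)
    exact hsm.tsum_ofReal_ne_top
  filter_upwards [ae_eventually_notMem hsum] with ω hω
  filter_upwards [hω] with n hn k hk
  by_contra hcon
  exact hn (Set.mem_biUnion (Finset.mem_coe.2 (Finset.mem_range.2 hk)) (le_of_lt (not_le.1 hcon)))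

lemma c_ratio (m : ℕ) (hm : 2 ≤ m) :
    9 * (3 * Real.sqrt ((m + 1 : ℕ) / 2 ^ (m + 1))) ≤ 8 * (3 * Real.sqrt (m / 2 ^ m)) := by
  have hm' : (2 : ℝ) ≤ m := by exact_mod_cast hm
  have h : Real.sqrt ((m + 1 : ℕ) / 2 ^ (m + 1)) ≤ 8 / 9 * Real.sqrt (m / 2 ^ m) := by
    apply Real.sqrt_le_iff.2
    refine ⟨by positivity, ?_⟩
    rw [mul_pow, Real.sq_sqrt (by positivity), pow_succ]
    push_cast
    have hp : (0 : ℝ) < 2 ^ m := by positivity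
    rw [div_le_iff₀ (by positivity)]
    field_simp
    linarith
  linarith

/-- chaining towards a point -/
lemma chain_point (b : ℝ → ℝ) (hb : Continuous b) (n0 : ℕ) (hn0 : 2 ≤ n0)
    (H : ∀ m ≥ n0, ∀ k : ℕ, k < 4 ^ m →
      |b (((k : ℝ) + 1) / 2 ^ m) - b ((k : ℝ) / 2 ^ m)| ≤ 3 * Real.sqrt (m / 2 ^ m))
    (t : ℝ) (ht0 : 0 ≤ t) (ht : t ≤ 2 ^ n0) (n : ℕ) (hn : n0 ≤ n) :
    |b t - b ((⌊2 ^ n * t⌋₊ : ℝ) / 2 ^ n)| ≤ 8 * (3 * Real.sqrt (n / 2 ^ n)) := by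
  have step : ∀ m, n0 ≤ m →
      |b ((⌊2 ^ (m + 1) * t⌋₊ : ℝ) / 2 ^ (m + 1)) - b ((⌊2 ^ m * t⌋₊ : ℝ) / 2 ^ m)| ≤
        3 * Real.sqrt ((m + 1 : ℕ) / 2 ^ (m + 1)) := by
    intro m hm
    have hp : (0 : ℝ) < 2 ^ m := by positivity
    set q := ⌊2 ^ m * t⌋₊ with hq
    have hq1 : (q : ℝ) ≤ 2 ^ m * t := Nat.floor_le (by positivity)
    have hq2 : 2 ^ m * t < q + 1 := Nat.lt_floor_add_one _
    have hq4 : q ≤ 4 ^ m := by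
      have : (q : ℝ) ≤ 4 ^ m := by
        refine hq1.trans ?_
        calc (2 : ℝ) ^ m * t ≤ 2 ^ m * 2 ^ n0 := by gcongr
          _ ≤ 2 ^ m * 2 ^ m := by gcongr; norm_num
          _ = 4 ^ m := by rw [← mul_pow]; norm_num
      exact_mod_cast this
    have hlt : 2 * q < 4 ^ (m + 1) := by
      have : 0 < 4 ^ m := by positivity
      rw [pow_succ]
      omega
    have e0 : (q : ℝ) / 2 ^ m = ((2 * q : ℕ) : ℝ) / 2 ^ (m + 1) := by
      push_cast
      rw [pow_succ]
      field_simp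
    rcases lt_or_ge (2 ^ (m + 1) * t) (2 * q + 1 : ℝ) with h | h
    · have hf : ⌊2 ^ (m + 1) * t⌋₊ = 2 * q := by
        rw [Nat.floor_eq_iff (by positivity)]
        push_cast
        refine ⟨?_, h⟩
        rw [pow_succ]; linarith
      rw [hf, e0]
      simp only [sub_self, abs_zero]
      positivity
    · have hf : ⌊2 ^ (m + 1) * t⌋₊ = 2 * q + 1 := by
        rw [Nat.floor_eq_iff (by positivity)]
        push_cast
        refine ⟨h, ?_⟩
        rw [pow_succ]; linarith
      have := H (m + 1) (by omega) (2 * q) hlt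
      rw [hf, e0]
      push_cast at this ⊢
      exact this
  have key : ∀ j : ℕ,
      |b ((⌊2 ^ (n + j) * t⌋₊ : ℝ) / 2 ^ (n + j)) - b ((⌊2 ^ n * t⌋₊ : ℝ) / 2 ^ n)| ≤
        8 * (3 * Real.sqrt (n / 2 ^ n)) - 8 * (3 * Real.sqrt ((n + j : ℕ) / 2 ^ (n + j))) := by
    intro j
    induction j with
    | zero => simp
    | succ j ih =>
      have h1 := step (n + j) (by omega)
      have h2 := c_ratio (n + j) (by omega)
      have h3 := abs_sub_le (b ((⌊2 ^ (n + (j + 1)) * t⌋₊ : ℝ) / 2 ^ (n + (j + 1))))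
        (b ((⌊2 ^ (n + j) * t⌋₊ : ℝ) / 2 ^ (n + j))) (b ((⌊2 ^ n * t⌋₊ : ℝ) / 2 ^ n))
      rw [← add_assoc] at h3 ⊢
      linarith
  have hlim : Tendsto (fun j : ℕ => (⌊2 ^ (n + j) * t⌋₊ : ℝ) / 2 ^ (n + j)) atTop (nhds t) := by
    have h1 := tendsto_nat_floor_mul_div_atTop (R := ℝ) (a := t) ht0
    have h2 : Tendsto (fun j : ℕ => (2 : ℝ) ^ (n + j)) atTop atTop := by
      have := tendsto_pow_atTop_atTop_of_one_lt (r := (2 : ℝ)) (by norm_num)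
      exact this.comp (tendsto_atTop_mono (fun j => Nat.le_add_left j n) tendsto_id)
    have h3 := h1.comp h2
    refine h3.congr fun j => ?_
    simp only [Function.comp]
    rw [mul_comm t]
  have hlim2 := (((hb.tendsto t).comp hlim).sub_const (b ((⌊2 ^ n * t⌋₊ : ℝ) / 2 ^ n))).abs
  refine le_of_tendsto hlim2 (Eventually.of_forall fun j => (key j).trans ?_)
  have : 0 ≤ 8 * (3 * Real.sqrt ((n + j : ℕ) / 2 ^ (n + j))) := by positivity
  linarith

lemma chain_modulus (b : ℝ → ℝ) (hb : Continuous b) (n0 : ℕ) (hn0 : 2 ≤ n0)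
    (H : ∀ m ≥ n0, ∀ k : ℕ, k < 4 ^ m →
      |b (((k : ℝ) + 1) / 2 ^ m) - b ((k : ℝ) / 2 ^ m)| ≤ 3 * Real.sqrt (m / 2 ^ m))
    (s t : ℝ) (hs0 : 0 ≤ s) (hst : s < t) (ht : t ≤ 2 ^ n0) (n : ℕ) (hn : n0 ≤ n)
    (hd : t - s ≤ 1 / 2 ^ n) :
    |b t - b s| ≤ 51 * Real.sqrt (n / 2 ^ n) := by
  have hp : (0 : ℝ) < 2 ^ n := by positivity
  have h1 := chain_point b hb n0 hn0 H t (hs0.trans hst.le) ht n hn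
  have h2 := chain_point b hb n0 hn0 H s hs0 (hst.le.trans ht) n hn
  have hmul : 2 ^ n * t ≤ 2 ^ n * s + 1 := by
    rw [le_div_iff₀ hp] at hd
    linarith
  have h3 : |b ((⌊2 ^ n * t⌋₊ : ℝ) / 2 ^ n) - b ((⌊2 ^ n * s⌋₊ : ℝ) / 2 ^ n)| ≤
      3 * Real.sqrt (n / 2 ^ n) := by
    set q := ⌊2 ^ n * s⌋₊ with hq
    have hq1 : (q : ℝ) ≤ 2 ^ n * s := Nat.floor_le (by positivity)
    have hq2 : 2 ^ n * s < q + 1 := Nat.lt_floor_add_one _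
    have hst' : 2 ^ n * s < 2 ^ n * t := by gcongr
    have ht0 : 0 ≤ 2 ^ n * t := mul_nonneg hp.le (hs0.trans hst.le)
    have hq4 : q < 4 ^ n := by
      have : (q : ℝ) < 4 ^ n := by
        refine hq1.trans_lt ?_
        calc (2 : ℝ) ^ n * s < 2 ^ n * 2 ^ n0 := by gcongr; linarith
          _ ≤ 2 ^ n * 2 ^ n := by gcongr; norm_num
          _ = 4 ^ n := by rw [← mul_pow]; norm_num
      exact_mod_cast this
    rcases lt_or_ge (2 ^ n * t) (q + 1 : ℝ) with h | h
    · have hf : ⌊2 ^ n * t⌋₊ = q := by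
        rw [Nat.floor_eq_iff ht0]
        exact ⟨by linarith, h⟩
      rw [hf]
      simp only [sub_self, abs_zero]
      positivity
    · have hf : ⌊2 ^ n * t⌋₊ = q + 1 := by
        rw [Nat.floor_eq_iff ht0]
        push_cast
        exact ⟨h, by linarith⟩
      rw [hf]
      push_cast
      exact H n hn q hq4
  rw [abs_le] at *
  constructor <;> linarith [h1.1, h1.2, h2.1, h2.2, h3.1, h3.2]

/-- `Y_t ≤ W_τ - W_t` -/
lemma path_bound_s4 (w y : ℝ → ℝ) (T : ℝ) (hT : 0 < T) (hw : Continuous w)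
    (hc : ContinuousOn y (Set.Ico 0 T))
    (hy : ∀ t : ℝ, 0 ≤ t → t < T → 0 < y t ∧ y t = 1 - w t + ∫ s in (0 : ℝ)..t, 2 / y s)
    (hl : Filter.liminf y (nhdsWithin T (Set.Iio T)) = 0) (t : ℝ) (ht0 : 0 ≤ t) (htT : t < T) :
    y t ≤ w T - w t := by
  have hci : ContinuousOn (fun s => 2 / y s) (Set.Ico 0 T) :=
    continuousOn_const.div hc fun s hs => (hy s hs.1 hs.2).1.ne'
  have hii : ∀ a b, 0 ≤ a → a ≤ b → b < T → IntervalIntegrable (fun s => 2 / y s) volume a b := by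
    intro a b ha hab hb
    apply ContinuousOn.intervalIntegrable_of_Icc hab
    exact hci.mono fun s hs => ⟨ha.trans hs.1, hs.2.trans_lt hb⟩
  have hinc : ∀ a b, 0 ≤ a → a ≤ b → b < T →
      y b = y a - (w b - w a) + ∫ s in a..b, 2 / y s := by
    intro a b ha hab hb
    have := intervalIntegral.integral_add_adjacent_intervals
      (hii 0 a le_rfl ha (hab.trans_lt hb)) (hii a b ha hab hb)
    rw [(hy b (ha.trans hab) hb).2, (hy a ha (hab.trans_lt hb)).2, ← this]
    ring
  have hfreq : ∀ ε > 0, ∃ᶠ u in nhdsWithin T (Set.Iio T), y u < ε := by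
    intro ε hε hcon
    have hcon' : ∀ᶠ u in nhdsWithin T (Set.Iio T), ε ≤ y u := by
      filter_upwards [hcon] with u hu using not_lt.1 hu
    obtain ⟨a, haT, ha⟩ := (mem_nhdsLT_iff_exists_Ioo_subset' hT).1 hcon'
    set c1 := max 0 ((a + T) / 2) with hcdef
    have haTlt : a < T := haT
    have hcT : c1 < T := max_lt hT (by linarith)
    have hc0 : 0 ≤ c1 := le_max_left _ _
    have hac : a < c1 := lt_of_lt_of_le (by linarith) (le_max_right _ _)
    obtain ⟨M, hM⟩ := (isCompact_Icc (a := (0 : ℝ)) (b := T)).bddBelow_image hw.continuousOn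
    have hbd : ∀ u, c1 < u → u < T → y u ≤ y c1 + w c1 - M + 2 / ε * (T - c1) := by
      intro u hau hu
      have h1 := hinc c1 u hc0 hau.le hu
      have h2 : w u ≥ M := hM ⟨u, ⟨by linarith, hu.le⟩, rfl⟩
      have h3 : ∫ s in c1..u, 2 / y s ≤ ∫ s in c1..u, 2 / ε := by
        apply intervalIntegral.integral_mono_on hau.le (hii c1 u hc0 hau.le hu) (by simp)
        intro s hs
        have : ε ≤ y s := ha ⟨hac.trans_le hs.1, hs.2.trans_lt hu⟩
        gcongr
      have h4 : ∫ s in c1..u, 2 / ε = (u - c1) * (2 / ε) := by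
        simp
        ring
      have h5 : (u - c1) * (2 / ε) ≤ (T - c1) * (2 / ε) := by gcongr
      linarith
    have hcob : (nhdsWithin T (Set.Iio T)).IsCoboundedUnder (· ≥ ·) y := by
      apply Filter.IsBoundedUnder.isCoboundedUnder_ge
      refine ⟨y c1 + w c1 - M + 2 / ε * (T - c1), ?_⟩
      rw [eventually_map]
      filter_upwards [Ioo_mem_nhdsLT hcT] with u hu using hbd u hu.1 hu.2
    have := le_liminf_of_le hcob hcon'
    linarith
  apply le_of_forall_pos_le_add
  intro ε hε
  have hwT : ∀ᶠ u in nhdsWithin T (Set.Iio T), w u < w T + ε / 2 :=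
    (hw.tendsto T).mono_left nhdsWithin_le_nhds |>.eventually (gt_mem_nhds (by linarith))
  obtain ⟨u, hu1, hu2, hu3⟩ :=
    ((hfreq (ε / 2) (by linarith)).and_eventually (hwT.and (Ioo_mem_nhdsLT htT))).exists
  have h1 := hinc t u ht0 hu3.1.le hu3.2
  have h2 : 0 ≤ ∫ s in t..u, 2 / y s := by
    apply intervalIntegral.integral_nonneg hu3.1.le
    intro s hs
    have := (hy s (ht0.trans hs.1) (hs.2.trans_lt hu3.2)).1
    positivity
  linarith

/-- divergence of the integral from the dyadic bounds -/
lemma diverge (y : ℝ → ℝ) (T D : ℝ) (hD : 0 < D) (n1 : ℕ) (hn1 : 1 ≤ n1)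
    (hT : 1 / 2 ^ n1 ≤ T) (hpos : ∀ t, 0 ≤ t → t < T → 0 < y t)
    (hy : ∀ n ≥ n1, ∀ t, 0 ≤ t → t < T → T - t ≤ 1 / 2 ^ n → y t ^ 2 ≤ D * (n / 2 ^ n)) :
    ∫⁻ t in Set.Ioo (0 : ℝ) T, ENNReal.ofReal (1 / (y t) ^ 2) = ⊤ := by
  let I : ℕ → Set ℝ := fun j => Set.Ioo (T - 1 / 2 ^ (n1 + j)) (T - 1 / 2 ^ (n1 + j + 1))
  have hle : ∀ i j : ℕ, i ≤ j → (1 : ℝ) / 2 ^ j ≤ 1 / 2 ^ i := by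
    intro i j hij
    gcongr
    norm_num
  have hsub : (⋃ j, I j) ⊆ Set.Ioo 0 T := by
    refine Set.iUnion_subset fun j t ht => ?_
    have h1 := hle n1 (n1 + j) (by omega)
    have h2 : (0 : ℝ) < 1 / 2 ^ (n1 + j + 1) := by positivity
    exact ⟨by linarith [ht.1], by linarith [ht.2]⟩
  have hdis : Pairwise (Function.onFun Disjoint I) := by
    have key : ∀ i j : ℕ, i < j → Disjoint (I i) (I j) := by
      intro i j hij
      rw [Set.disjoint_left]
      intro t hi hj
      have := hle (n1 + i + 1) (n1 + j) (by omega)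
      linarith [hi.2, hj.1]
    intro i j hij
    rcases lt_or_gt_of_ne hij with h | h
    · exact key i j h
    · exact (key j i h).symm
  have hI : ∀ j, ENNReal.ofReal (1 / (2 * D) * (1 / ((n1 + j : ℕ) : ℝ))) ≤
      ∫⁻ t in I j, ENNReal.ofReal (1 / (y t) ^ 2) := by
    intro j
    have hn : (0 : ℝ) < ((n1 + j : ℕ) : ℝ) := by
      have : 0 < n1 + j := by omega
      exact_mod_cast this
    have hp : (0 : ℝ) < 2 ^ (n1 + j) := by positivity
    calc ENNReal.ofReal (1 / (2 * D) * (1 / ((n1 + j : ℕ) : ℝ)))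
        = ∫⁻ t in I j, ENNReal.ofReal (2 ^ (n1 + j) / (D * ((n1 + j : ℕ) : ℝ))) := by
          rw [setLIntegral_const, Real.volume_Ioo, ← ENNReal.ofReal_mul (by positivity)]
          congr 1
          rw [pow_succ]
          field_simp
          ring
      _ ≤ _ := by
          refine setLIntegral_mono' measurableSet_Ioo fun t ht => ?_
          have htm := hsub (Set.mem_iUnion.2 ⟨j, ht⟩)
          have h0 := hpos t htm.1.le htm.2
          have h1 := hy (n1 + j) (by omega) t htm.1.le htm.2 (by linarith [ht.1])
          apply ENNReal.ofReal_le_ofReal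
          rw [div_le_div_iff₀ (by positivity) (by positivity)]
          calc 2 ^ (n1 + j) * y t ^ 2 ≤ 2 ^ (n1 + j) * (D * (((n1 + j : ℕ) : ℝ) / 2 ^ (n1 + j))) := by
                gcongr
            _ = 1 * (D * ((n1 + j : ℕ) : ℝ)) := by
                field_simp
  rw [eq_top_iff]
  calc ⊤ = ∑' j : ℕ, ENNReal.ofReal (1 / (2 * D) * (1 / ((n1 + j : ℕ) : ℝ))) := by
        by_contra hne
        have hs := ENNReal.summable_toReal (Ne.symm hne)
        have e : (fun j : ℕ => (ENNReal.ofReal (1 / (2 * D) * (1 / ((n1 + j : ℕ) : ℝ)))).toReal) =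
            fun j : ℕ => 1 / (2 * D) * (1 / ((j + n1 : ℕ) : ℝ)) := by
          funext j
          rw [ENNReal.toReal_ofReal (by positivity), add_comm]
        rw [e, summable_mul_left_iff (by positivity)] at hs
        exact Real.not_summable_one_div_natCast
          ((summable_nat_add_iff (f := fun n : ℕ => 1 / (n : ℝ)) n1).1 hs)
    _ ≤ ∑' j, ∫⁻ t in I j, ENNReal.ofReal (1 / (y t) ^ 2) := ENNReal.tsum_le_tsum hI
    _ = ∫⁻ t in ⋃ j, I j, ENNReal.ofReal (1 / (y t) ^ 2) :=
        (lintegral_iUnion (fun j => measurableSet_Ioo) hdis _).symm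
    _ ≤ _ := lintegral_mono_set hsub

/-- Let `κ > 4`, `W = √κ·B` for a standard Brownian motion `B`, let `τ` be a
random time (almost surely positive and finite), and let `Y` be a process which is, almost
surely, continuous and positive on `[0, τ)`, satisfies `Y_t = 1 − W_t + ∫_0^t (2/Y_s) ds`
there, and has `liminf_{t↑τ} Y_t = 0` (so `Y/√κ` is a Bessel process of dimension
`1 + 4/κ < 2` started from `1/√κ`, run until it first hits `0`). Then almost surely
`∫_0^τ dt/Y_t² = ∞`. -/
theorem stmt4 {Ω : Type*} [MeasurableSpace Ω] (μ : Measure Ω) [IsProbabilityMeasure μ]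
    (κ : ℝ) (hκ : 4 < κ)
    (B : ℝ → Ω → ℝ) (hB : IsStandardBrownianMotion μ B)
    (W : ℝ → Ω → ℝ) (hW : ∀ t ω, W t ω = Real.sqrt κ * B t ω)
    (τ : Ω → ℝ) (Y : ℝ → Ω → ℝ)
    (hY : ∀ᵐ ω ∂μ, 0 < τ ω ∧
      ContinuousOn (fun t => Y t ω) (Set.Ico 0 (τ ω)) ∧
      (∀ t : ℝ, 0 ≤ t → t < τ ω →
        0 < Y t ω ∧ Y t ω = 1 - W t ω + ∫ s in (0 : ℝ)..t, 2 / Y s ω) ∧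
      Filter.liminf (fun t => Y t ω) (nhdsWithin (τ ω) (Set.Iio (τ ω))) = 0) :
    ∀ᵐ ω ∂μ, ∫⁻ t in Set.Ioo (0 : ℝ) (τ ω), ENNReal.ofReal (1 / (Y t ω) ^ 2) = ⊤ := by
  have hκ0 : 0 < κ := by linarith
  filter_upwards [hY, bm_dyadic hB] with ω hω hdy
  obtain ⟨hT, hc, hy, hl⟩ := hω
  have hb := hB.1 ω
  have hwc : Continuous fun t => W t ω := by
    simp only [hW]
    exact continuous_const.mul hb
  have hpb := path_bound_s4 (fun t => W t ω) (fun t => Y t ω) (τ ω) hT hwc hc hy hl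
  have ev1 : ∀ᶠ n : ℕ in atTop, τ ω ≤ 2 ^ n :=
    (tendsto_pow_atTop_atTop_of_one_lt (r := (2 : ℝ)) (by norm_num)).eventually_ge_atTop _
  have ev2 : ∀ᶠ n : ℕ in atTop, 1 / τ ω ≤ 2 ^ n :=
    (tendsto_pow_atTop_atTop_of_one_lt (r := (2 : ℝ)) (by norm_num)).eventually_ge_atTop _
  obtain ⟨N, hN⟩ := eventually_atTop.1 hdy
  obtain ⟨n0, h1, h2, h3, h4⟩ :=
    (ev1.and (ev2.and ((eventually_ge_atTop 2).and (eventually_ge_atTop N)))).exists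
  refine diverge (fun t => Y t ω) (τ ω) (κ * 51 ^ 2) (by positivity) n0 (by omega) ?_
    (fun t ht0 htT => (hy t ht0 htT).1) ?_
  · rw [div_le_iff₀ (by positivity)]
    rw [div_le_iff₀ hT] at h2
    linarith
  · intro n hn t ht0 htT hd
    have hm := chain_modulus (fun t => B t ω) hb n0 h3 (fun m hm => hN m (h4.trans hm))
      t (τ ω) ht0 htT h1 n hn hd
    have hle : Y t ω ≤ Real.sqrt κ * (51 * Real.sqrt (n / 2 ^ n)) := by
      have := hpb t ht0 htT
      simp only [hW] at this
      rw [← mul_sub] at this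
      refine this.trans ?_
      gcongr
      exact (le_abs_self _).trans hm
    have h0 := (hy t ht0 htT).1
    calc Y t ω ^ 2 ≤ (Real.sqrt κ * (51 * Real.sqrt (n / 2 ^ n))) ^ 2 := by gcongr
      _ = κ * 51 ^ 2 * (n / 2 ^ n) := by
        rw [mul_pow, mul_pow, Real.sq_sqrt hκ0.le, Real.sq_sqrt (by positivity)]
        ring
end

section
/- Let κ > 4, α = 1 − 4/κ ∈ (0,1), and θ ∈ (0,π). For r > 0 let h(r·e^{iθ}) = ∫_{[0, r e^{iθ}]} w^{−4/κ}·(1−w)^{4/κ−1} dw, the contour integral along the straight segment from 0 to r·e^{iθ}, with principal-branch complex powers (the integral converges at 0 since −4/κ > −1, and the integrand is well defined since neither w nor 1−w lies in (−∞,0] along the segment). Let φ(z) = Re z − cot(απ)·Im z. Then lim_{r→∞} φ(h(r·e^{iθ})) = B(α, 1−α)·(1 − θ/π) = (π/ sin(απ))·(1 − θ/π), where B denotes the Euler Beta function. -/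
open Complex Real Filter

lemma key_pow (w : ℂ) (hw : 0 < w.im) (α : ℝ) :
    w ^ ((α - 1 : ℝ) : ℂ) * (1 - w) ^ ((-α : ℝ) : ℂ) * w
      = Complex.exp ((α * π : ℝ) * Complex.I) * (1 - w⁻¹) ^ ((-α : ℝ) : ℂ) := by
  have w0 : w ≠ 0 := by rintro rfl; simp at hw
  have him : 0 < (1 - w⁻¹).im := by
    simp only [Complex.sub_im, Complex.one_im, Complex.inv_im]
    have : 0 < Complex.normSq w := Complex.normSq_pos.2 w0
    have h2 : -w.im / Complex.normSq w = - (w.im / Complex.normSq w) := by ring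
    rw [h2]
    have := div_pos hw this
    linarith
  have hv0 : 1 - w⁻¹ ≠ 0 := by intro h; rw [h] at him; simp at him
  have h10 : 1 - w ≠ 0 := by
    intro h
    have := congrArg Complex.im h
    simp at this
    linarith
  have harg : Complex.arg (-w) = Complex.arg w - π := Complex.arg_neg_eq_arg_sub_pi_of_im_pos hw
  have hargneg : Complex.arg (-w) < 0 := Complex.arg_neg_iff.2 (by simpa using hw)
  have hargv : 0 ≤ Complex.arg (1 - w⁻¹) := Complex.arg_nonneg_iff.2 him.le
  have hmul : 1 - w = (-w) * (1 - w⁻¹) := by field_simp; ring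
  have hlogneg : Complex.log (-w) = Complex.log w - π * Complex.I := by
    rw [Complex.log, Complex.log, harg, norm_neg]; push_cast; ring
  have hlog : Complex.log (1 - w) = Complex.log w - π * Complex.I + Complex.log (1 - w⁻¹) := by
    rw [hmul, Complex.log_mul (neg_ne_zero.2 w0) hv0, hlogneg]
    constructor
    · have := Complex.neg_pi_lt_arg (-w); linarith
    · have := Complex.arg_le_pi (1 - w⁻¹); linarith
  rw [Complex.cpow_def_of_ne_zero w0, Complex.cpow_def_of_ne_zero h10,
    Complex.cpow_def_of_ne_zero hv0, hlog]
  have hE : ∀ A : ℂ, A * w = A * Complex.exp (Complex.log w) := by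
    intro A; rw [Complex.exp_log w0]
  rw [hE, ← Complex.exp_add, ← Complex.exp_add, ← Complex.exp_add]
  congr 1
  push_cast
  ring

noncomputable def Gfun (α : ℝ) (ζ : ℂ) : ℂ := (1 - Complex.exp (-ζ)) ^ ((-α : ℝ) : ℂ)

lemma slit_aux (ζ : ℂ) (h0 : 0 < ζ.im) (h1 : ζ.im ≤ π) :
    1 - Complex.exp (-ζ) ∈ Complex.slitPlane := by
  rcases h1.lt_or_eq with h | h
  · right
    simp only [Complex.sub_im, Complex.one_im, Complex.exp_im, Complex.neg_im, Complex.neg_re,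
      Real.sin_neg]
    have := mul_pos (Real.exp_pos (-ζ.re)) (Real.sin_pos_of_pos_of_lt_pi h0 h)
    intro h3; linarith
  · left
    simp only [Complex.sub_re, Complex.one_re, Complex.exp_re, Complex.neg_im, Complex.neg_re,
      Real.cos_neg, h, Real.cos_pi]
    have := Real.exp_pos (-ζ.re)
    linarith

lemma Gfun_diff (α : ℝ) (ζ : ℂ) (h0 : 0 < ζ.im) (h1 : ζ.im ≤ π) :
    DifferentiableAt ℂ (Gfun α) ζ := by
  unfold Gfun
  apply DifferentiableAt.cpow
  · fun_prop
  · fun_prop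
  · exact slit_aux ζ h0 h1

lemma rect_im (α θ : ℝ) (hθ : θ ∈ Set.Ioo (0 : ℝ) π) (a L : ℝ) :
    (∫ x in a..L, Gfun α (x + θ * Complex.I)).im =
      (∫ y in θ..π, Gfun α (a + y * Complex.I)).re
      - (∫ y in θ..π, Gfun α (L + y * Complex.I)).re := by
  have H := Complex.integral_boundary_rect_eq_zero_of_differentiableOn (Gfun α)
    (⟨a, θ⟩ : ℂ) (⟨L, π⟩ : ℂ) (by
      intro ζ hζ
      apply DifferentiableAt.differentiableWithinAt
      have h2 := hζ.2
      simp only [Set.mem_preimage, Set.uIcc_of_le hθ.2.le, Set.mem_Icc] at h2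
      exact Gfun_diff α ζ (hθ.1.trans_le h2.1) h2.2)
  simp only at H
  have hreal : (∫ x in a..L, Gfun α (x + π * Complex.I))
      = ((∫ x in a..L, (1 + Real.exp (-x)) ^ (-α) : ℝ) : ℂ) := by
    rw [← intervalIntegral.integral_ofReal]
    congr 1
    ext x
    have : 1 - Complex.exp (-(x + π * Complex.I)) = ((1 + Real.exp (-x) : ℝ) : ℂ) := by
      rw [neg_add, Complex.exp_add, Complex.exp_neg (π * Complex.I), Complex.exp_pi_mul_I]
      push_cast; norm_num
    rw [Gfun, this, ← Complex.ofReal_cpow (by positivity)]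
  rw [hreal] at H
  have := congrArg Complex.im H
  simp only [Complex.sub_im, Complex.add_im, Complex.ofReal_im, smul_eq_mul, Complex.I_mul_im,
    Complex.zero_im] at this
  linarith

lemma norm_aux1 (x y : ℝ) : ‖Complex.exp (-(x + y * Complex.I))‖ = Real.exp (-x) := by
  rw [Complex.norm_exp]; simp

lemma meas_aux (α θ : ℝ) (hθ : θ ∈ Set.Ioo (0 : ℝ) π) (a : ℝ) :
    MeasureTheory.AEStronglyMeasurable (fun y : ℝ => Gfun α (a + y * Complex.I))
      (MeasureTheory.volume.restrict (Set.uIoc θ π)) := by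
  apply ContinuousOn.aestronglyMeasurable _ measurableSet_uIoc
  intro y hy
  rw [Set.uIoc_of_le hθ.2.le] at hy
  apply ContinuousAt.continuousWithinAt
  apply ContinuousAt.comp (f := fun y : ℝ => (a + y * Complex.I : ℂ)) (g := Gfun α)
  · exact (Gfun_diff α _ (by simpa using hθ.1.trans hy.1) (by simpa using hy.2)).continuousAt
  · fun_prop

lemma lim_top (α θ : ℝ) (hα : 0 < α) (hθ : θ ∈ Set.Ioo (0 : ℝ) π) :
    Tendsto (fun L : ℝ => ∫ y in θ..π, Gfun α (L + y * Complex.I)) atTop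
      (nhds ((π - θ : ℝ) : ℂ)) := by
  have e : ((π - θ : ℝ) : ℂ) = ∫ y in θ..π, (1 : ℂ) := by simp
  rw [e]
  have hexp : Tendsto (fun L : ℝ => Real.exp (-L)) atTop (nhds 0) :=
    Real.tendsto_exp_neg_atTop_nhds_zero
  apply intervalIntegral.tendsto_integral_filter_of_dominated_convergence
    (fun _ => (1 / 2 : ℝ) ^ (-α))
  · exact Eventually.of_forall fun a => meas_aux α θ hθ a
  · filter_upwards [hexp.eventually (gt_mem_nhds (show (0 : ℝ) < 1 / 2 by norm_num))] with L hL
    refine Eventually.of_forall fun y _ => ?_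
    rw [Gfun, Complex.norm_cpow_real]
    apply Real.rpow_le_rpow_of_nonpos (by norm_num) _ (by linarith)
    have := norm_sub_norm_le (1 : ℂ) (Complex.exp (-(L + y * Complex.I)))
    rw [norm_aux1, norm_one] at this
    linarith
  · exact intervalIntegrable_const
  · refine Eventually.of_forall fun y _ => ?_
    have h1 : Tendsto (fun L : ℝ => Complex.exp (-(L + y * Complex.I))) atTop (nhds 0) := by
      rw [tendsto_zero_iff_norm_tendsto_zero]
      simpa only [norm_aux1] using hexp
    have h2 : Tendsto (fun L : ℝ => 1 - Complex.exp (-(L + y * Complex.I))) atTop (nhds 1) := by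
      simpa only [sub_zero] using h1.const_sub 1
    have h3 : ContinuousAt (fun z : ℂ => z ^ ((-α : ℝ) : ℂ)) 1 :=
      continuousAt_id.cpow continuousAt_const (by simp)
    have h4 := h3.tendsto.comp h2
    simpa only [Function.comp_def, Gfun, Complex.one_cpow] using h4

lemma lim_bot (α θ : ℝ) (hα : 0 < α) (hθ : θ ∈ Set.Ioo (0 : ℝ) π) :
    Tendsto (fun L : ℝ => ∫ y in θ..π, Gfun α (L + y * Complex.I)) atBot (nhds 0) := by
  have e : (0 : ℂ) = ∫ y in θ..π, (0 : ℂ) := by simp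
  rw [e]
  have hexp : Tendsto (fun L : ℝ => Real.exp (-L) - 1) atBot atTop :=
    tendsto_atTop_add_const_right _ _ (Real.tendsto_exp_atTop.comp tendsto_neg_atBot_atTop)
  have hb : ∀ L y : ℝ, Real.exp (-L) - 1 ≤ ‖1 - Complex.exp (-(L + y * Complex.I))‖ := by
    intro L y
    have := norm_sub_norm_le (Complex.exp (-(L + y * Complex.I))) (1 : ℂ)
    rw [norm_aux1, norm_one, norm_sub_rev] at this
    exact this
  apply intervalIntegral.tendsto_integral_filter_of_dominated_convergence
    (fun _ => (1 : ℝ) ^ (-α))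
  · exact Eventually.of_forall fun a => meas_aux α θ hθ a
  · filter_upwards [hexp.eventually_ge_atTop 1] with L hL
    refine Eventually.of_forall fun y _ => ?_
    rw [Gfun, Complex.norm_cpow_real]
    exact Real.rpow_le_rpow_of_nonpos (by norm_num) (hL.trans (hb L y)) (by linarith)
  · exact intervalIntegrable_const
  · refine Eventually.of_forall fun y _ => ?_
    rw [tendsto_zero_iff_norm_tendsto_zero]
    simp only [Gfun, Complex.norm_cpow_real]
    exact (tendsto_rpow_neg_atTop hα).comp (tendsto_atTop_mono (fun L => hb L y) hexp)

lemma beta_val (α : ℝ) (h0 : 0 < α) (h1 : α < 1) :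
    (∫ t in (0 : ℝ)..1, t ^ (α - 1) * (1 - t) ^ ((1 - α) - 1)) = π / Real.sin (α * π) := by
  have H := Complex.Gamma_mul_Gamma_eq_betaIntegral (s := (α : ℂ)) (t := ((1 - α : ℝ) : ℂ))
    (by simpa using h0) (by simpa using h1)
  have e : Complex.betaIntegral (α : ℂ) ((1 - α : ℝ) : ℂ)
      = ((∫ t in (0 : ℝ)..1, t ^ (α - 1) * (1 - t) ^ ((1 - α) - 1) : ℝ) : ℂ) := by
    rw [Complex.betaIntegral, ← intervalIntegral.integral_ofReal]
    apply intervalIntegral.integral_congr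
    intro t ht
    rw [Set.uIcc_of_le zero_le_one] at ht
    simp only
    rw [Complex.ofReal_mul, Complex.ofReal_cpow ht.1, Complex.ofReal_cpow (by linarith [ht.2])]
    push_cast
    rfl
  rw [e] at H
  have h2 : (α : ℂ) + ((1 - α : ℝ) : ℂ) = 1 := by push_cast; ring
  rw [h2, Complex.Gamma_one, one_mul, Complex.Gamma_ofReal, Complex.Gamma_ofReal,
    ← Complex.ofReal_mul] at H
  have H' := Complex.ofReal_injective H
  rw [← H', Real.Gamma_mul_Gamma_one_sub, mul_comm]

lemma pow_integrable (α : ℝ) (h0 : 0 < α) (z : ℂ) (hz : 0 < z.im) :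
    IntervalIntegrable (fun t : ℝ => (((t : ℂ) * z) ^ ((α - 1 : ℝ) : ℂ)
      * (1 - (t : ℂ) * z) ^ ((-α : ℝ) : ℂ)) * z) MeasureTheory.volume 0 1 := by
  have z0 : z ≠ 0 := by rintro rfl; simp at hz
  have h1 : IntervalIntegrable (fun t : ℝ => ((t : ℂ) ^ ((α - 1 : ℝ) : ℂ)))
      MeasureTheory.volume 0 1 :=
    intervalIntegral.intervalIntegrable_cpow' (by rw [Complex.ofReal_re]; linarith)
  have h2 : IntervalIntegrable (fun t : ℝ => (t : ℂ) ^ ((α - 1 : ℝ) : ℂ) *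
      (z ^ ((α - 1 : ℝ) : ℂ) * (1 - (t : ℂ) * z) ^ ((-α : ℝ) : ℂ) * z))
      MeasureTheory.volume 0 1 := by
    apply IntervalIntegrable.mul_continuousOn h1
    apply ContinuousOn.mul _ continuousOn_const
    apply ContinuousOn.mul continuousOn_const
    intro t ht
    apply ContinuousAt.continuousWithinAt
    apply ContinuousAt.cpow (by fun_prop) (by fun_prop)
    rw [Set.uIcc_of_le zero_le_one] at ht
    rcases ht.1.eq_or_lt with h | h
    · rw [← h]; simp
    · right
      have := mul_pos h hz
      rw [Complex.sub_im, Complex.one_im, Complex.im_ofReal_mul]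
      intro h3; linarith
  refine h2.congr_uIoo ?_
  intro t ht
  rw [Set.uIoo_of_le zero_le_one] at ht
  simp only
  have ht0 : (t : ℂ) ≠ 0 := by exact_mod_cast ht.1.ne'
  have : ((t : ℂ) * z) ^ ((α - 1 : ℝ) : ℂ)
      = (t : ℂ) ^ ((α - 1 : ℝ) : ℂ) * z ^ ((α - 1 : ℝ) : ℂ) := by
    rw [Complex.cpow_def_of_ne_zero (mul_ne_zero ht0 z0), Complex.cpow_def_of_ne_zero ht0,
      Complex.cpow_def_of_ne_zero z0, Complex.log_ofReal_mul ht.1 z0, ← Complex.exp_add,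
      Complex.ofReal_log ht.1.le]
    congr 1
    ring
  rw [this]
  ring

lemma h_im (α θ : ℝ) (h0 : 0 < α) (hθ : θ ∈ Set.Ioo (0 : ℝ) π) (r : ℝ) (hr : 0 < r)
    (z : ℂ) (hz : z = (r : ℂ) * Complex.exp ((θ : ℂ) * Complex.I)) :
    (Complex.exp (-((α * π : ℝ) * Complex.I)) * ∫ t in (0 : ℝ)..1,
      (((t : ℂ) * z) ^ ((α - 1 : ℝ) : ℂ) * (1 - (t : ℂ) * z) ^ ((-α : ℝ) : ℂ)) * z).im
      = - (∫ y in θ..π, Gfun α (Real.log r + y * Complex.I)).re := by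
  have hzim : 0 < z.im := by
    rw [hz, Complex.im_ofReal_mul, Complex.exp_ofReal_mul_I_im]
    exact mul_pos hr (Real.sin_pos_of_pos_of_lt_pi hθ.1 hθ.2)
  have hzexp : z = Complex.exp (Real.log r + θ * Complex.I) := by
    rw [Complex.exp_add, ← Complex.ofReal_exp, Real.exp_log hr, hz]
  set F : ℝ → ℂ := fun t => (((t : ℂ) * z) ^ ((α - 1 : ℝ) : ℂ)
    * (1 - (t : ℂ) * z) ^ ((-α : ℝ) : ℂ)) * z with hF
  have hint : IntervalIntegrable F MeasureTheory.volume 0 1 := pow_integrable α h0 z hzim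
  have hlim : Tendsto (fun a : ℝ => ∫ t in (Real.exp a)..1, F t) atBot
      (nhds (∫ t in (0 : ℝ)..1, F t)) := by
    have hc := intervalIntegral.continuousOn_primitive_interval_left (f := F) (a := 0) (b := 1)
      (μ := MeasureTheory.volume)
      ((intervalIntegrable_iff' (by simp)).1 hint)
    have hc0 := hc 0 Set.left_mem_uIcc
    refine hc0.tendsto.comp ?_
    rw [tendsto_nhdsWithin_iff]
    refine ⟨Real.tendsto_exp_atBot, ?_⟩
    filter_upwards [eventually_le_atBot 0] with a ha
    rw [Set.uIcc_of_le zero_le_one]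
    exact ⟨(Real.exp_pos a).le, Real.exp_le_one_iff.2 ha⟩
  have hFc : ∀ t : ℝ, 0 < t → ContinuousAt F t := by
    intro t ht
    have h1 : 0 < ((t : ℂ) * z).im := by rw [Complex.im_ofReal_mul]; exact mul_pos ht hzim
    apply ContinuousAt.mul _ continuousAt_const
    apply ContinuousAt.mul
    · apply ContinuousAt.cpow (by fun_prop) (by fun_prop)
      exact Or.inr h1.ne'
    · apply ContinuousAt.cpow (by fun_prop) (by fun_prop)
      right
      rw [Complex.sub_im, Complex.one_im]
      intro h; linarith
  have hsub : ∀ a : ℝ, (∫ t in (Real.exp a)..1, F t) = Complex.exp ((α * π : ℝ) * Complex.I) *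
      ∫ x in (a + Real.log r)..(Real.log r), Gfun α (x + θ * Complex.I) := by
    intro a
    have h1 := intervalIntegral.integral_deriv_smul_comp' (a := a) (b := 0) (f := Real.exp)
      (f' := Real.exp) (g := F) (fun x _ => Real.hasDerivAt_exp x)
      Real.continuous_exp.continuousOn (by
        rintro _ ⟨x, _, rfl⟩
        exact (hFc _ (Real.exp_pos x)).continuousWithinAt)
    rw [Real.exp_zero] at h1
    rw [← h1]
    have h2 := intervalIntegral.integral_comp_add_right (a := a) (b := 0)
      (fun x : ℝ => Gfun α (x + θ * Complex.I)) (Real.log r)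
    rw [zero_add] at h2
    rw [← h2, ← intervalIntegral.integral_const_mul]
    congr 1
    ext x
    have h3 : ((Real.exp x : ℝ) : ℂ) * z
        = Complex.exp (((x + Real.log r : ℝ) : ℂ) + θ * Complex.I) := by
      rw [hzexp, Complex.ofReal_exp, ← Complex.exp_add]; congr 1; push_cast; ring
    have h4 : 0 < (((Real.exp x : ℝ) : ℂ) * z).im := by
      rw [Complex.im_ofReal_mul]; exact mul_pos (Real.exp_pos x) hzim
    have h5 := key_pow _ h4 α
    rw [Gfun, Complex.exp_neg, ← h3, ← h5, Function.comp, hF]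
    simp only [Complex.real_smul]
    ring
  have hIm : ∀ a : ℝ, (Complex.exp (-((α * π : ℝ) * Complex.I)) * ∫ t in (Real.exp a)..1, F t).im
      = (∫ y in θ..π, Gfun α (((a + Real.log r : ℝ) : ℂ) + y * Complex.I)).re
      - (∫ y in θ..π, Gfun α (Real.log r + y * Complex.I)).re := by
    intro a
    rw [hsub, ← mul_assoc, ← Complex.exp_add, neg_add_cancel, Complex.exp_zero, one_mul]
    exact rect_im α θ hθ _ _
  have hL := (Complex.continuous_im.tendsto _).comp
    (hlim.const_mul (Complex.exp (-((α * π : ℝ) * Complex.I))))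
  have hR : Tendsto (fun a : ℝ =>
      (∫ y in θ..π, Gfun α (((a + Real.log r : ℝ) : ℂ) + y * Complex.I)).re
      - (∫ y in θ..π, Gfun α (Real.log r + y * Complex.I)).re) atBot
      (nhds (0 - (∫ y in θ..π, Gfun α (Real.log r + y * Complex.I)).re)) := by
    apply Tendsto.sub_const
    exact (Complex.continuous_re.tendsto _).comp ((lim_bot α θ h0 hθ).comp
      (tendsto_atBot_add_const_right atBot (Real.log r) tendsto_id))
  have := tendsto_nhds_unique hL (hR.congr fun a => (hIm a).symm)
  rw [this, zero_sub]

/-- For `κ > 4`, `α = 1 − 4/κ`, `θ ∈ (0,π)`, let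
`h(z) = ∫_{[0,z]} w^{−4/κ}·(1−w)^{4/κ−1} dw` (contour integral along the segment from `0`
to `z`, principal-branch powers) and `φ(z) = Re z − cot(απ)·Im z`. Then, with
`B(α,1−α) = ∫_0^1 t^{α−1}(1−t)^{−α} dt` the Euler Beta value, one has
`B(α,1−α) = π/sin(απ)` and `φ(h(r·e^{iθ})) → B(α,1−α)·(1 − θ/π)` as `r → ∞`. -/
theorem stmt9 (κ : ℝ) (hκ : 4 < κ) (α : ℝ) (hα : α = 1 - 4 / κ)
    (θ : ℝ) (hθ : θ ∈ Set.Ioo (0 : ℝ) π)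
    (h : ℂ → ℂ)
    (hh : ∀ z : ℂ, h z = ∫ t in (0 : ℝ)..1,
      (((t : ℂ) * z) ^ ((-(4 / κ) : ℝ) : ℂ) * (1 - (t : ℂ) * z) ^ ((4 / κ - 1 : ℝ) : ℂ)) * z)
    (φ : ℂ → ℝ) (hφ : ∀ z : ℂ, φ z = z.re - Real.cot (α * π) * z.im)
    (b : ℝ) (hb : b = ∫ t in (0 : ℝ)..1, t ^ (α - 1) * (1 - t) ^ ((1 - α) - 1)) :
    b = π / Real.sin (α * π) ∧
    Tendsto (fun r : ℝ => φ (h ((r : ℂ) * Complex.exp ((θ : ℂ) * Complex.I))))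
      atTop (nhds (b * (1 - θ / π))) := by
  have hκ0 : 0 < κ := by linarith
  have hq : 4 / κ < 1 := by rw [div_lt_one hκ0]; exact hκ
  have hq0 : 0 < 4 / κ := by positivity
  have h0 : 0 < α := by linarith
  have h1 : α < 1 := by linarith
  have hbv : b = π / Real.sin (α * π) := hb.trans (beta_val α h0 h1)
  refine ⟨hbv, ?_⟩
  have hsin : 0 < Real.sin (α * π) :=
    Real.sin_pos_of_pos_of_lt_pi (by positivity) (by nlinarith [Real.pi_pos])
  have e1 : -(4 / κ) = α - 1 := by linarith
  have e2 : 4 / κ - 1 = -α := by linarith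
  rw [e1, e2] at hh
  have hφ' : ∀ z : ℂ, φ z =
      -(Complex.exp (-((α * π : ℝ) * Complex.I)) * z).im / Real.sin (α * π) := by
    intro z
    rw [hφ, ← neg_mul, ← Complex.ofReal_neg, Complex.mul_im, Complex.exp_ofReal_mul_I_re,
      Complex.exp_ofReal_mul_I_im, Real.cos_neg, Real.sin_neg, Real.cot_eq_cos_div_sin]
    field_simp
    ring
  have hT := ((Complex.continuous_re.tendsto _).comp ((lim_top α θ h0 hθ).comp
    Real.tendsto_log_atTop)).div_const (Real.sin (α * π))
  have hlimval : b * (1 - θ / π) = (((π - θ : ℝ) : ℂ)).re / Real.sin (α * π) := by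
    rw [hbv, Complex.ofReal_re]
    field_simp
  rw [hlimval]
  refine hT.congr' ?_
  filter_upwards [eventually_gt_atTop 0] with r hr
  rw [hφ', hh, h_im α θ h0 hθ r hr _ rfl, neg_neg]
  rfl
end

section
/- Define F(w) = 2(√w + 1/√w) = 2(w+1)/√w for w in the upper half-plane ℍ, where √w is the principal branch square root. Then F'(w) = w^{−3/2}(w−1) for all w ∈ ℍ (principal-branch powers), and F is a biholomorphism from ℍ onto the slit half-plane {z ∈ ℂ : Re z > 0} ∖ [4, ∞); that is, the Schwarz–Christoffel map with derivative w^{−4/κ}(w−1)^{8/κ−2} for κ = 8/3 maps the upper half-plane conformally onto a slit half-plane. -/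
open Complex

lemma aux_half (w : ℂ) (hw : w ≠ 0) :
    w ^ ((1 / 2 : ℝ) : ℂ) * w ^ ((1 / 2 : ℝ) : ℂ) = w := by
  rw [← Complex.cpow_add _ _ hw]
  norm_num

lemma aux_re (w : ℂ) (hw : w ∈ slitPlane) : 0 < (w ^ ((1 / 2 : ℝ) : ℂ)).re := by
  have hw0 : w ≠ 0 := slitPlane_ne_zero hw
  rw [Complex.cpow_def_of_ne_zero hw0, Complex.exp_re]
  refine mul_pos (Real.exp_pos _) (Real.cos_pos_of_mem_Ioo ?_)
  rw [Complex.im_mul_ofReal, Complex.log_im]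
  have h1 := Complex.neg_pi_lt_arg w
  have h2 := Complex.arg_le_pi w
  have h3 : w.arg ≠ Real.pi := (Complex.mem_slitPlane_iff_arg.1 hw).1
  have h4 := lt_of_le_of_ne h2 h3
  constructor <;> linarith

lemma aux_sq (s : ℂ) (hs : 0 < s.re) (hi : 0 < s.im) :
    (s * s) ^ ((1 / 2 : ℝ) : ℂ) = s := by
  have him : 0 < (s * s).im := by
    rw [Complex.mul_im]; nlinarith [mul_pos hs hi]
  have hsl : s * s ∈ slitPlane := Or.inr him.ne'
  have h1 := aux_half _ (slitPlane_ne_zero hsl)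
  have h2 := aux_re _ hsl
  rcases mul_self_eq_mul_self_iff.1 h1 with h | h
  · exact h
  · rw [h, Complex.neg_re] at h2; linarith

lemma aux_quad (w : ℂ) (hw : 0 < w.im) : ∃ s : ℂ, w ^ ((1 / 2 : ℝ) : ℂ) = s ∧ s * s = w ∧
    0 < s.re ∧ 0 < s.im ∧ s ≠ 0 := by
  have hsl : w ∈ slitPlane := Or.inr hw.ne'
  have h1 := aux_half _ (slitPlane_ne_zero hsl)
  have h2 := aux_re _ hsl
  refine ⟨_, rfl, h1, h2, ?_, ?_⟩
  · generalize w ^ ((1 / 2 : ℝ) : ℂ) = s at *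
    rw [← h1, Complex.mul_im] at hw
    by_contra h
    nlinarith
  · intro h; rw [h] at h2; simp at h2

/-- The inverse of `2(s+1/s)`. -/
noncomputable def auxS (z : ℂ) : ℂ := (z + I * (16 - z * z) ^ ((1 / 2 : ℝ) : ℂ)) / 4

lemma aux_slit (z : ℂ) (hz : 0 < z.re) (hz' : ¬ (z.im = 0 ∧ 4 ≤ z.re)) :
    16 - z * z ∈ slitPlane := by
  rw [Complex.mem_slitPlane_iff]
  by_contra h
  push Not at h
  obtain ⟨h1, h2⟩ := h
  simp at h1 h2
  have h3 : z.im = 0 := by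
    have : z.re * z.im = 0 := by linarith
    rcases mul_eq_zero.1 this with h | h
    · linarith
    · exact h
  refine hz' ⟨h3, ?_⟩
  rw [h3] at h1
  nlinarith

lemma aux_inv_re (s t : ℂ) (h : s * t = 1) : t.re * normSq s = s.re ∧ t.im * normSq s = -s.im := by
  have h1 := congrArg Complex.re h
  have h2 := congrArg Complex.im h
  simp [Complex.mul_re, Complex.mul_im] at h1 h2
  rw [Complex.normSq_apply]
  constructor
  · linear_combination s.re * h1 + s.im * h2
  · linear_combination s.re * h2 - s.im * h1

lemma auxS_spec (z : ℂ) (hz : 0 < z.re) (hz' : ¬ (z.im = 0 ∧ 4 ≤ z.re)) :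
    0 < (auxS z).re ∧ 0 < (auxS z).im ∧ 2 * (auxS z * auxS z + 1) = z * auxS z := by
  have hsl := aux_slit z hz hz'
  have h1 := aux_half _ (slitPlane_ne_zero hsl)
  have h2 := aux_re _ hsl
  unfold auxS
  generalize (16 - z * z) ^ ((1 / 2 : ℝ) : ℂ) = q at *
  obtain ⟨s, hs⟩ : ∃ s, s = (z + I * q) / 4 := ⟨_, rfl⟩
  obtain ⟨t, ht⟩ : ∃ t, t = (z - I * q) / 4 := ⟨_, rfl⟩
  rw [← hs]
  have hst : s * t = 1 := by
    rw [hs, ht]; linear_combination (1/16) * h1 - (1/16) * q * q * I_mul_I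
  have hsum : z = 2 * (s + t) := by rw [hs, ht]; ring
  have hdif : I * q = 2 * (s - t) := by rw [hs, ht]; ring
  obtain ⟨h3, h4⟩ := aux_inv_re s t hst
  have hn : 0 < normSq s := by
    rw [Complex.normSq_pos]; rintro rfl; simp at hst
  have h5 := congrArg Complex.re hsum
  have h6 := congrArg Complex.im hdif
  simp at h5 h6
  refine ⟨?_, ?_, ?_⟩
  · by_contra h
    have : t.re ≤ 0 := by by_contra h'; nlinarith
    linarith
  · by_contra h
    have : 0 ≤ t.im := by by_contra h'; nlinarith
    linarith
  · rw [hsum]; linear_combination (-2) * hst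

/-- `F(w) = 2(w+1)/√w` (principal branch square root) has
`F'(w) = w^{−3/2}(w−1)` on the upper half-plane, and is a biholomorphism from the upper
half-plane onto the slit half-plane `{Re z > 0} ∖ [4, ∞)`: the Schwarz–Christoffel map
with derivative `w^{−4/κ}(w−1)^{8/κ−2}` for `κ = 8/3` maps the upper half-plane
conformally onto a slit half-plane. -/
theorem stmt11 (F : ℂ → ℂ)
    (hF : ∀ w : ℂ, 0 < w.im → F w = 2 * (w + 1) / w ^ ((1 / 2 : ℝ) : ℂ))
    (T : Set ℂ)
    (hT : T = {z : ℂ | 0 < z.re} \ {z : ℂ | z.im = 0 ∧ 4 ≤ z.re}) :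
    (∀ w : ℂ, 0 < w.im →
      HasDerivAt F (w ^ ((-(3 / 2) : ℝ) : ℂ) * (w - 1)) w) ∧
    Set.BijOn F {w : ℂ | 0 < w.im} T ∧
    (∃ G : ℂ → ℂ, DifferentiableOn ℂ G T ∧
      (∀ w : ℂ, 0 < w.im → G (F w) = w) ∧ (∀ z ∈ T, F (G z) = z)) := by
  have hd : ∀ w : ℂ, 0 < w.im →
      HasDerivAt F (w ^ ((-(3 / 2) : ℝ) : ℂ) * (w - 1)) w := by
    intro w hw
    have hsl : w ∈ slitPlane := Or.inr hw.ne'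
    have hw0 := slitPlane_ne_zero hsl
    have hev : F =ᶠ[nhds w] fun w => 2 * (w + 1) / w ^ ((1 / 2 : ℝ) : ℂ) := by
      filter_upwards [(isOpen_lt continuous_const Complex.continuous_im).mem_nhds hw] with x hx
      exact hF x hx
    refine HasDerivAt.congr_of_eventuallyEq ?_ hev
    obtain ⟨s, hs, hss, -, -, hs0⟩ := aux_quad w hw
    have hp := (hasDerivAt_id w).cpow_const (c := ((1 / 2 : ℝ) : ℂ)) hsl
    have hq := (((hasDerivAt_id w).add_const 1).const_mul 2).div hp (by simpa using hw0)
    refine hq.congr_deriv ?_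
    have e1 : w ^ ((-(3 / 2) : ℝ) : ℂ) = s / (w * w) := by
      rw [show ((-(3 / 2) : ℝ) : ℂ) = ((1 / 2 : ℝ) : ℂ) - 1 - 1 by push_cast; ring,
        Complex.cpow_sub _ _ hw0, Complex.cpow_sub _ _ hw0, hs, Complex.cpow_one]
      field_simp
    have e2 : w ^ (((1 / 2 : ℝ) : ℂ) - 1) = s / w := by
      rw [Complex.cpow_sub _ _ hw0, hs, Complex.cpow_one]
    simp only [id]
    rw [e1, e2, hs, ← hss]
    push_cast
    field_simp
    ring
  have hmaps : ∀ w : ℂ, 0 < w.im → F w ∈ T := by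
    intro w hw
    obtain ⟨s, hs, hss, hr, hi, hs0⟩ := aux_quad w hw
    have hst : s * s⁻¹ = 1 := mul_inv_cancel₀ hs0
    have hFw : F w = 2 * (s + s⁻¹) := by
      rw [hF w hw, hs, ← hss]; field_simp
    have hn : 0 < normSq s := Complex.normSq_pos.2 hs0
    obtain ⟨h3, h4⟩ := aux_inv_re s _ hst
    have h5 : 0 < (s⁻¹).re := by by_contra h; nlinarith
    have h7 := congrArg Complex.re hFw
    have h8 := congrArg Complex.im hFw
    have h9 := congrArg Complex.re hst
    generalize s⁻¹ = t at *
    simp at h7 h8 h9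
    rw [hT]
    refine ⟨?_, ?_⟩
    · change 0 < (F w).re
      rw [h7]; linarith
    · rintro ⟨h10, h11⟩
      have ht : t.im = -s.im := by linarith
      have h12 : normSq s = 1 := by
        rw [ht] at h4
        have : s.im * (normSq s - 1) = 0 := by linarith
        rcases mul_eq_zero.1 this with h | h <;> linarith
      rw [h12] at h3
      have h13 : t.re = s.re := by linarith
      rw [Complex.normSq_apply] at h12
      have : 0 < s.im * s.im := mul_pos hi hi
      nlinarith
  have hinj : ∀ w : ℂ, 0 < w.im → ∀ v : ℂ, 0 < v.im → F w = F v → w = v := by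
    intro w hw v hv h
    obtain ⟨s, hs, hss, hr, hi, hs0⟩ := aux_quad w hw
    obtain ⟨t, ht, htt, htr, hti, ht0⟩ := aux_quad v hv
    rw [hF w hw, hF v hv, hs, ht, ← hss, ← htt] at h
    field_simp at h
    have h1 : (s - t) * (s * t - 1) = 0 := by linear_combination h
    rcases mul_eq_zero.1 h1 with h2 | h2
    · rw [← hss, ← htt, sub_eq_zero.1 h2]
    · exfalso
      obtain ⟨-, h4⟩ := aux_inv_re s t (sub_eq_zero.1 h2)
      have hn : 0 < normSq s := Complex.normSq_pos.2 hs0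
      nlinarith [mul_pos hti hn]
  have hG : ∀ z ∈ T, 0 < (auxS z * auxS z).im ∧ F (auxS z * auxS z) = z := by
    intro z hz
    rw [hT] at hz
    obtain ⟨h1, h2, h3⟩ := auxS_spec z hz.1 hz.2
    have him : 0 < (auxS z * auxS z).im := by
      rw [Complex.mul_im]; nlinarith [mul_pos h1 h2]
    refine ⟨him, ?_⟩
    rw [hF _ him, aux_sq _ h1 h2, h3]
    refine mul_div_cancel_right₀ _ ?_
    intro h; rw [h] at h1; simp at h1
  refine ⟨hd, ⟨fun w hw => hmaps w hw, fun w hw v hv h => hinj w hw v hv h,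
    fun z hz => ⟨_, (hG z hz).1, (hG z hz).2⟩⟩, fun z => auxS z * auxS z, ?_, ?_, ?_⟩
  · intro z hz
    have hz2 := hz
    rw [hT] at hz2
    have hsl := aux_slit z hz2.1 hz2.2
    have hS : DifferentiableAt ℂ auxS z := by
      unfold auxS
      have h1 : DifferentiableAt ℂ (fun z : ℂ => 16 - z * z) z := by fun_prop
      have h2 : DifferentiableAt ℂ (fun z : ℂ => (16 - z * z) ^ ((1 / 2 : ℝ) : ℂ)) z :=
        h1.cpow (differentiableAt_const _) hsl
      exact (differentiableAt_id.add (h2.const_mul I)).div_const 4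
    exact (hS.mul hS).differentiableWithinAt
  · intro w hw
    exact hinj _ (hG _ (hmaps w hw)).1 _ hw (hG _ (hmaps w hw)).2
  · intro z hz
    exact (hG z hz).2
end

section
/- Let 0 < κ < 8/3, and let F be a holomorphic function on the upper half-plane ℍ with F'(w) = w^{−4/κ}·(w−1)^{8/κ−2} for all w ∈ ℍ (principal-branch complex powers; such an antiderivative exists since ℍ is simply connected). Then F is not injective on ℍ; that is, for κ < 8/3 the candidate Schwarz–Christoffel map ceases to be univalent. -/
open Complex

/-- The auxiliary function `B(t) = -2 i sinh((t + iθ)/2)`, given by real and imaginary part. -/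
noncomputable def auxB (θ t : ℝ) : ℂ :=
  ⟨2 * Real.cosh (t / 2) * Real.sin (θ / 2), -(2 * Real.sinh (t / 2) * Real.cos (θ / 2))⟩

lemma auxB_re_pos (θ t : ℝ) (h0 : 0 < θ) (h1 : θ < Real.pi) : 0 < (auxB θ t).re := by
  have := Real.sin_pos_of_pos_of_lt_pi (x := θ / 2) (by linarith) (by linarith)
  have := Real.cosh_pos (t / 2)
  simp only [auxB]
  positivity

lemma auxB_neg (θ t : ℝ) : auxB θ (-t) = (starRingEnd ℂ) (auxB θ t) := by
  apply Complex.ext <;> simp [auxB, neg_div]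

lemma auxB_eq (θ t : ℝ) :
    Complex.exp (t + θ * I) - 1 = Complex.exp ((t + θ * I) / 2) * (I * auxB θ t) := by
  have h : I * auxB θ t = 2 * Complex.sinh ((t + θ * I) / 2) := by
    have : ((t : ℂ) + θ * I) / 2 = ((t / 2 : ℝ) : ℂ) + ((θ / 2 : ℝ) : ℂ) * I := by
      push_cast; ring
    rw [this, Complex.sinh_add, Complex.cosh_mul_I, Complex.sinh_mul_I,
      ← Complex.ofReal_cosh, ← Complex.ofReal_sinh, ← Complex.ofReal_cos, ← Complex.ofReal_sin]
    simp only [auxB]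
    generalize Real.sinh (t / 2) = a
    generalize Real.cosh (t / 2) = b
    generalize Real.sin (θ / 2) = c
    generalize Real.cos (θ / 2) = d
    apply Complex.ext <;> simp <;> ring
  rw [h, Complex.sinh]
  have e1 : Complex.exp (t + θ * I)
      = Complex.exp ((t + θ * I) / 2) * Complex.exp ((t + θ * I) / 2) := by
    rw [← Complex.exp_add]; congr 1; ring
  have e2 : Complex.exp ((t + θ * I) / 2) * Complex.exp (-((t + θ * I) / 2)) = 1 := by
    rw [← Complex.exp_add]; simp
  rw [e1]
  linear_combination e2

lemma exp_im_pos (θ t : ℝ) (h0 : 0 < θ) (h1 : θ < Real.pi) :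
    0 < (Complex.exp (t + θ * I)).im := by
  have := Real.sin_pos_of_pos_of_lt_pi h0 h1
  rw [Complex.exp_im]
  simp
  positivity

lemma key (θ t p : ℝ) (h0 : 0 < θ) (h1 : θ < Real.pi) :
    Complex.exp (t + θ * I) ^ ((-(p / 2 + 1) : ℝ) : ℂ)
      * (Complex.exp (t + θ * I) - 1) ^ (p : ℂ) * Complex.exp (t + θ * I)
      = Complex.exp (p * (Real.pi / 2 * I)) * auxB θ t ^ (p : ℂ) := by
  have hB := auxB_re_pos θ t h0 h1
  have hB0 : auxB θ t ≠ 0 := by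
    intro h; rw [h] at hB; simp at hB
  have hlog : Complex.log (Complex.exp (t + θ * I)) = t + θ * I := by
    apply Complex.log_exp <;> simp <;> linarith [Real.pi_pos]
  have harg := (Complex.abs_arg_lt_pi_div_two_iff (z := auxB θ t)).2 (Or.inl hB)
  rw [abs_lt] at harg
  set L : ℂ := (t + θ * I) / 2 + (Real.pi / 2 * I + Complex.log (auxB θ t)) with hL
  have hexp : Complex.exp (t + θ * I) - 1 = Complex.exp L := by
    rw [auxB_eq, hL, Complex.exp_add, Complex.exp_add, Complex.exp_log hB0,
      Complex.exp_pi_div_two_mul_I]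
  have hLim : L.im = θ / 2 + (Real.pi / 2 + (auxB θ t).arg) := by
    rw [hL]
    simp [Complex.log_im]
  have hpos : 0 < (Complex.exp L).im := by
    rw [← hexp]
    simpa using exp_im_pos θ t h0 h1
  have hlt : L.im ≤ Real.pi := by
    by_contra hc
    push Not at hc
    rw [Complex.exp_im] at hpos
    have : 0 < Real.sin L.im := by
      by_contra hs
      push Not at hs
      nlinarith [Real.exp_pos L.re]
    have h2 : 0 < Real.sin (L.im - Real.pi) :=
      Real.sin_pos_of_pos_of_lt_pi (by linarith) (by linarith)
    rw [Real.sin_sub_pi] at h2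
    linarith
  have hlog2 : Complex.log (Complex.exp (t + θ * I) - 1) = L := by
    rw [hexp]
    exact Complex.log_exp (by linarith [Real.pi_pos]) hlt
  rw [Complex.cpow_def_of_ne_zero (Complex.exp_ne_zero _),
    Complex.cpow_def_of_ne_zero (by rw [hexp]; exact Complex.exp_ne_zero _),
    Complex.cpow_def_of_ne_zero hB0, hlog, hlog2, ← Complex.exp_add, ← Complex.exp_add,
    ← Complex.exp_add, hL]
  congr 1
  push_cast
  ring

/-- Along the chosen ray, `Re (B ^ p)` is eventually bounded above by a negative constant. -/
lemma ev_neg (p : ℝ) (hp : 1 < p) :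
    ∃ δ > 0, ∃ T : ℝ, 0 ≤ T ∧ ∀ t ≥ T,
      (auxB (Real.pi - 2 * (Real.pi / (p + 1))) t ^ (p : ℂ)).re ≤ -δ := by
  set ψ := Real.pi / (p + 1) with hψ
  have hpi := Real.pi_pos
  have hψ0 : 0 < ψ := by positivity
  have hψp : p * ψ = Real.pi - ψ := by rw [hψ]; field_simp; ring
  have hψ1 : ψ < Real.pi / 2 := by nlinarith
  have hs : Real.sin ((Real.pi - 2 * ψ) / 2) = Real.cos ψ := by
    rw [← Real.sin_pi_div_two_sub]; congr 1; ring
  have hc : Real.cos ((Real.pi - 2 * ψ) / 2) = Real.sin ψ := by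
    rw [← Real.cos_pi_div_two_sub]; congr 1; ring
  have hcos : 0 < Real.cos ψ := Real.cos_pos_of_mem_Ioo ⟨by linarith, hψ1⟩
  let C : ℝ → ℂ := fun t => ((1 + Real.exp (-t)) * Real.cos ψ : ℝ)
    - ((1 - Real.exp (-t)) * Real.sin ψ : ℝ) * I
  have hBC : ∀ t, auxB (Real.pi - 2 * ψ) t = ((Real.exp (t / 2) : ℝ) : ℂ) * C t := by
    intro t
    have e : Real.exp (t / 2) * Real.exp (-t) = Real.exp (-(t / 2)) := by
      rw [← Real.exp_add]; congr 1; ring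
    apply Complex.ext
    · simp only [auxB, hs, C, Real.cosh_eq]
      rw [← e]
      rw [Complex.re_ofReal_mul]
      simp only [Complex.sub_re, Complex.ofReal_re, Complex.re_ofReal_mul, Complex.I_re]
      ring
    · simp only [auxB, hc, C, Real.sinh_eq]
      rw [← e]
      rw [Complex.im_ofReal_mul]
      simp only [Complex.sub_im, Complex.ofReal_im, Complex.im_ofReal_mul, Complex.I_im]
      ring
  have he : Filter.Tendsto (fun t : ℝ => Real.exp (-t)) Filter.atTop (nhds 0) :=
    Real.tendsto_exp_neg_atTop_nhds_zero
  have hlim : Filter.Tendsto C Filter.atTop (nhds (Complex.exp (-(ψ : ℂ) * I))) := by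
    have hcont : Continuous (fun x : ℝ => (((1 + x) * Real.cos ψ : ℝ) : ℂ)
      - ((1 - x) * Real.sin ψ : ℝ) * I) := by fun_prop
    have := (hcont.tendsto 0).comp he
    have hval0 : Complex.exp (-(ψ : ℂ) * I) = (((1 + 0) * Real.cos ψ : ℝ) : ℂ)
        - ((1 - 0) * Real.sin ψ : ℝ) * I := by
      rw [Complex.exp_mul_I, Complex.cos_neg, Complex.sin_neg]
      simp
      ring
    rw [hval0]
    exact this
  have hlog : Complex.log (Complex.exp (-(ψ : ℂ) * I)) = -(ψ : ℂ) * I := by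
    apply Complex.log_exp <;> simp <;> linarith
  have hlim2 : Filter.Tendsto (fun t => (C t ^ (p : ℂ)).re) Filter.atTop
      (nhds ((Complex.exp (-(ψ : ℂ) * I) ^ (p : ℂ)).re)) := by
    have h1 : Complex.exp (-(ψ : ℂ) * I) ∈ Complex.slitPlane := by
      left
      rw [Complex.exp_mul_I]
      have : (Complex.cos (-(ψ : ℂ)) + Complex.sin (-(ψ : ℂ)) * I).re = Real.cos ψ := by
        rw [Complex.cos_neg, Complex.sin_neg, ← Complex.ofReal_cos, ← Complex.ofReal_sin]
        simp [-Complex.ofReal_cos, -Complex.ofReal_sin]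
      rw [this]; exact hcos
    exact (Complex.continuous_re.tendsto _).comp
      (((continuousAt_cpow_const h1).tendsto).comp hlim)
  have hval : (Complex.exp (-(ψ : ℂ) * I) ^ (p : ℂ)).re = -Real.cos ψ := by
    rw [Complex.cpow_def_of_ne_zero (Complex.exp_ne_zero _), hlog]
    have : -(ψ : ℂ) * I * p = ((ψ - Real.pi : ℝ) : ℂ) * I := by
      have : (p : ℂ) * ψ = Real.pi - ψ := by exact_mod_cast hψp
      push_cast
      linear_combination -I * this
    rw [this, Complex.exp_ofReal_mul_I_re, Real.cos_sub_pi]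
  rw [hval] at hlim2
  have hev := hlim2.eventually (gt_mem_nhds (show -Real.cos ψ < -(Real.cos ψ / 2) by linarith))
  obtain ⟨T, hT⟩ := Filter.eventually_atTop.1 hev
  refine ⟨Real.cos ψ / 2, by positivity, max T 0, le_max_right _ _, fun t ht => ?_⟩
  have hCt := hT t (le_trans (le_max_left _ _) ht)
  have ht0 : 0 ≤ t := le_trans (le_max_right _ _) ht
  have hC0 : C t ≠ 0 := by
    intro h
    have h2 : (C t).re = (1 + Real.exp (-t)) * Real.cos ψ := by
      simp only [C, Complex.sub_re, Complex.ofReal_re, Complex.re_ofReal_mul, Complex.I_re]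
      ring
    rw [h] at h2
    have : 0 < (1 + Real.exp (-t)) * Real.cos ψ := by positivity
    simp at h2
    rcases h2 with h2 | h2 <;> [linarith [Real.exp_pos (-t)]; linarith]
  have hprod : (((Real.exp (t / 2) : ℝ) : ℂ) * C t) ^ (p : ℂ)
      = ((Real.exp (t / 2 * p) : ℝ) : ℂ) * C t ^ (p : ℂ) := by
    have hx := Real.exp_pos (t / 2)
    rw [Complex.cpow_def_of_ne_zero (mul_ne_zero (by exact_mod_cast hx.ne') hC0),
      Complex.log_ofReal_mul hx hC0, Complex.cpow_def_of_ne_zero hC0, Real.log_exp,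
      Complex.ofReal_exp, ← Complex.exp_add]
    congr 1
    push_cast
    ring
  rw [hBC, hprod, Complex.re_ofReal_mul]
  have h1 : 1 ≤ Real.exp (t / 2 * p) := Real.one_le_exp (by positivity)
  nlinarith

/-- For `0 < κ < 8/3`, any holomorphic `F` on the upper half-plane with
`F'(w) = w^{−4/κ}·(w−1)^{8/κ−2}` (principal-branch powers) fails to be injective there:
the candidate Schwarz–Christoffel map ceases to be univalent. -/
theorem stmt12 (κ : ℝ) (hκ0 : 0 < κ) (hκ : κ < 8 / 3)
    (F : ℂ → ℂ)
    (hF : ∀ w : ℂ, 0 < w.im →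
      HasDerivAt F (w ^ ((-(4 / κ) : ℝ) : ℂ) * (w - 1) ^ ((8 / κ - 2 : ℝ) : ℂ)) w) :
    ¬ Set.InjOn F {z : ℂ | 0 < z.im} := by
  intro hinj
  obtain ⟨p, hp⟩ : ∃ p : ℝ, p = 8 / κ - 2 := ⟨_, rfl⟩
  have hp1 : 1 < p := by
    have : 3 < 8 / κ := by rw [lt_div_iff₀ hκ0]; linarith
    linarith
  have ha : -(4 / κ) = -(p / 2 + 1) := by rw [hp]; ring
  rw [ha, ← hp] at hF
  obtain ⟨δ, hδ, T, hT0, hT⟩ := ev_neg p hp1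
  have hpi := Real.pi_pos
  have hψ0 : 0 < Real.pi / (p + 1) := by positivity
  have hψ1 : 2 * (Real.pi / (p + 1)) < Real.pi := by
    rw [← mul_div_assoc, div_lt_iff₀ (by linarith)]; nlinarith
  set θ := Real.pi - 2 * (Real.pi / (p + 1)) with hθ
  have h0 : 0 < θ := by linarith
  have h1 : θ < Real.pi := by linarith
  have hH : ∀ t : ℝ, HasDerivAt (fun t : ℝ => F (Complex.exp (t + θ * I)))
      (Complex.exp (p * (Real.pi / 2 * I)) * auxB θ t ^ (p : ℂ)) t := by
    intro t
    have hd : HasDerivAt (fun z : ℂ => Complex.exp (z + θ * I)) (Complex.exp (t + θ * I)) (t : ℂ) := by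
      simpa using ((hasDerivAt_id (t : ℂ)).add_const (θ * I : ℂ)).cexp
    have := (HasDerivAt.comp (t : ℂ) (hF _ (exp_im_pos θ t h0 h1)) hd).comp_ofReal
    rw [key θ t p h0 h1] at this
    exact this
  let D : ℝ → ℂ := fun t => Complex.exp (-(p * (Real.pi / 2 * I))) *
    (F (Complex.exp (t + θ * I)) - F (Complex.exp ((-t : ℝ) + θ * I)))
  have hD : ∀ t, HasDerivAt D ((2 * (auxB θ t ^ (p : ℂ)).re : ℝ) : ℂ) t := by
    intro t
    have hn : HasDerivAt (fun t : ℝ => F (Complex.exp ((-t : ℝ) + θ * I)))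
        (-(Complex.exp (p * (Real.pi / 2 * I)) * auxB θ (-t) ^ (p : ℂ))) t := by
      have := HasDerivAt.scomp t (hH (-t)) (hasDerivAt_neg t)
      simpa [Function.comp_def] using this
    have h := ((hH t).sub hn).const_mul (Complex.exp (-(p * (Real.pi / 2 * I))))
    suffices hs : ((2 * (auxB θ t ^ (p : ℂ)).re : ℝ) : ℂ) = Complex.exp (-(p * (Real.pi / 2 * I))) *
        (Complex.exp (p * (Real.pi / 2 * I)) * auxB θ t ^ (p : ℂ)
          - -(Complex.exp (p * (Real.pi / 2 * I)) * auxB θ (-t) ^ (p : ℂ))) by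
      rw [hs]; exact h
    have harg : (auxB θ t).arg ≠ Real.pi := by
      have := (Complex.abs_arg_lt_pi_div_two_iff (z := auxB θ t)).2
        (Or.inl (auxB_re_pos θ t h0 h1))
      rw [abs_lt] at this
      intro hh; linarith
    have hconj : auxB θ (-t) ^ (p : ℂ) = (starRingEnd ℂ) (auxB θ t ^ (p : ℂ)) := by
      rw [auxB_neg, Complex.conj_cpow _ _ harg, Complex.conj_ofReal]
    rw [hconj]
    have e2 : Complex.exp (-(p * (Real.pi / 2 * I))) * Complex.exp (p * (Real.pi / 2 * I)) = 1 := by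
      rw [← Complex.exp_add]; simp
    rw [← Complex.add_conj]
    linear_combination -(auxB θ t ^ (p : ℂ) + (starRingEnd ℂ) (auxB θ t ^ (p : ℂ))) * e2
  have hre : ∀ t, HasDerivAt (fun t => (D t).re) (2 * (auxB θ t ^ (p : ℂ)).re) t := by
    intro t
    have := (Complex.reCLM.hasFDerivAt (x := D t)).comp_hasDerivAt t (hD t)
    simpa [Function.comp_def] using this
  have him : ∀ t, HasDerivAt (fun t => (D t).im) 0 t := by
    intro t
    have := (Complex.imCLM.hasFDerivAt (x := D t)).comp_hasDerivAt t (hD t)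
    simpa [Function.comp_def] using this
  have hD0 : D 0 = 0 := by simp [D]
  have him0 : ∀ t, (D t).im = 0 := by
    intro t
    have := is_const_of_deriv_eq_zero (f := fun t => (D t).im)
      (fun t => (him t).differentiableAt) (fun t => (him t).deriv) t 0
    simpa [hD0] using this
  have hcont : Continuous (fun t => (D t).re) :=
    continuous_iff_continuousAt.2 fun t => (hre t).continuousAt
  obtain ⟨t1, ht1, hpos⟩ : ∃ t1 > 0, 0 < (D t1).re := by
    have hpos0 : 0 < 2 * (auxB θ 0 ^ (p : ℂ)).re := by
      have hb : auxB θ 0 = ((2 * Real.sin (θ / 2) : ℝ) : ℂ) := by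
        apply Complex.ext <;> simp [auxB, -Complex.ofReal_sin]
      have hs := Real.sin_pos_of_pos_of_lt_pi (x := θ / 2) (by linarith) (by linarith)
      rw [hb, ← Complex.ofReal_cpow (by positivity), Complex.ofReal_re]
      positivity
    have hsl := (hasDerivAt_iff_tendsto_slope.1 (hre 0)).eventually (lt_mem_nhds hpos0)
    have hsl2 : ∀ᶠ t in nhdsWithin (0 : ℝ) (Set.Ioi 0), 0 < slope (fun t => (D t).re) 0 t :=
      hsl.filter_mono (nhdsWithin_mono _ (fun x hx => ne_of_gt hx))
    obtain ⟨t, ht, htq⟩ := (hsl2.and self_mem_nhdsWithin).exists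
    have htpp : 0 < t := htq
    refine ⟨t, htpp, ?_⟩
    rw [slope_def_field] at ht
    simp only [hD0, Complex.zero_re, sub_zero] at ht
    exact (div_pos_iff_of_pos_right htpp).1 ht
  obtain ⟨t2, ht2, hneg⟩ : ∃ t2 ≥ t1, (D t2).re ≤ 0 := by
    have hanti : AntitoneOn (fun t => (D t).re + 2 * δ * t) (Set.Ici T) := by
      have hd : ∀ t, HasDerivAt (fun t => (D t).re + 2 * δ * t)
          (2 * (auxB θ t ^ (p : ℂ)).re + 2 * δ * 1) t :=
        fun t => (hre t).add ((hasDerivAt_id t).const_mul (2 * δ))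
      apply antitoneOn_of_deriv_nonpos (convex_Ici T)
      · exact fun t _ => (hd t).continuousAt.continuousWithinAt
      · exact fun t _ => (hd t).differentiableAt.differentiableWithinAt
      · intro t ht
        rw [interior_Ici] at ht
        rw [(hd t).deriv]
        have := hT t (le_of_lt ht)
        linarith
    let t2 := max (max t1 T) (T + (D T).re / (2 * δ))
    have hA : t1 ≤ t2 := le_trans (le_max_left _ _) (le_max_left _ _)
    have hB : T ≤ t2 := le_trans (le_max_right _ _) (le_max_left _ _)
    have hC : T + (D T).re / (2 * δ) ≤ t2 := le_max_right _ _
    refine ⟨t2, hA, ?_⟩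
    have h := hanti (Set.mem_Ici.2 le_rfl) (Set.mem_Ici.2 hB) hB
    simp only at h
    have h3 : (D T).re ≤ (t2 - T) * (2 * δ) := by
      rw [← div_le_iff₀ (by positivity)]; linarith
    nlinarith
  obtain ⟨t, ht, hzero⟩ := intermediate_value_Icc' ht2 hcont.continuousOn ⟨hneg, hpos.le⟩
  have htpos : 0 < t := lt_of_lt_of_le ht1 ht.1
  have hDt : D t = 0 := Complex.ext hzero (him0 t)
  have hFeq : F (Complex.exp (t + θ * I)) = F (Complex.exp ((-t : ℝ) + θ * I)) := by
    rcases mul_eq_zero.1 hDt with h | h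
    · exact absurd h (Complex.exp_ne_zero _)
    · exact sub_eq_zero.1 h
  have heq := hinj (exp_im_pos θ t h0 h1) (exp_im_pos θ (-t) h0 h1) hFeq
  have hnorm := congrArg norm heq
  rw [Complex.norm_exp, Complex.norm_exp] at hnorm
  have := Real.exp_injective hnorm
  simp at this
  linarith
end
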